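/- arXiv:2507.17041 — 4 statements merged into one kernel-verified Lean document; each statement's English description precedes it below -/
import Mathlib

section
/- Let 3 ≤ ℓ ≤ (K−2)/2 be integers, D ≥ 1 an odd square-free integer, and χ a primitive Dirichlet character mod D. Then |2σ_{ℓ−1,χ}(0)/ζ(1−K)| ≤ 2 ((ℓ−1)D/(K−1))^{ℓ−1/2} (2πe/(K−1))^{K−ℓ}, where σ_{ℓ−1,χ}(0) = (ℓ−1)! D^ℓ L(ℓ,χ̄)/((−2πi)^ℓ G(χ̄)) and ζ(1−K) = −2(K−1)! ζ(K)/(2π)^K (up to sign, via the functional equation for even K). -/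
open Real Complex

/-- The Gauss sum `G(f) = ∑_{a mod D} f(a) e^{2πia/D}`. -/
noncomputable def gaussSumOf (D : ℕ) (f : ℕ → ℂ) : ℂ :=
  ∑ a ∈ Finset.range D, f a * Complex.exp (2 * (π : ℂ) * Complex.I * a / D)

/-- `σ_{ℓ−1,χ}(0) = (ℓ−1)! D^ℓ L(ℓ,χ̄) / ((−2πi)^ℓ G(χ̄))`, where the argument `f`
is the conjugate character `χ̄`. -/
noncomputable def sigmaZero (D k : ℕ) (f : ℕ → ℂ) : ℂ :=
  ((k - 1).factorial : ℂ) * (D : ℂ) ^ k * (∑' n : ℕ+, f (n : ℕ) / ((n : ℕ) : ℂ) ^ k)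
    / ((-(2 * (π : ℂ) * Complex.I)) ^ k * gaussSumOf D f)

lemma gauss_eq (D : ℕ) [NeZero D] (χ : DirichletCharacter ℂ D) :
    gaussSumOf D (fun m => (starRingEnd ℂ) (χ ((m : ℕ) : ZMod D)))
      = gaussSum χ⁻¹ (ZMod.stdAddChar (N := D)) := by
  unfold gaussSumOf gaussSum
  refine Finset.sum_bij (fun a _ => (a : ZMod D)) (by simp) ?_ ?_ ?_
  · intro a ha b hb hab
    rw [ZMod.natCast_eq_natCast_iff'] at hab
    rwa [Nat.mod_eq_of_lt (by simpa using ha), Nat.mod_eq_of_lt (by simpa using hb)] at hab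
  · intro b _
    exact ⟨b.val, by simpa using ZMod.val_lt b, by simp⟩
  · intro a _
    have := ZMod.stdAddChar_coe (N := D) (a : ℤ)
    push_cast at this
    rw [this, ← MulChar.star_apply']
    rfl

lemma gauss_norm (D : ℕ) [NeZero D] (χ : DirichletCharacter ℂ D) (hp : χ.IsPrimitive) :
    ‖gaussSum χ⁻¹ (ZMod.stdAddChar (N := D))‖ = √D := by
  have hu : ∀ ψ : DirichletCharacter ℂ D, ‖ψ (-1)‖ = 1 := fun ψ => by
    have := ψ.unit_norm_eq_one (-1 : (ZMod D)ˣ)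
    simpa using this
  have h1 := congrFun (ZMod.dft_dft (χ : ZMod D → ℂ)) 1
  have h2 : ZMod.dft (χ : ZMod D → ℂ) = fun k => χ⁻¹ (-k) * gaussSum χ ZMod.stdAddChar :=
    funext fun k => hp.fourierTransform_eq_inv_mul_gaussSum k
  rw [h2, ZMod.dft_mul_const, ZMod.dft_comp_neg] at h1
  have h3 := DirichletCharacter.fourierTransform_eq_gaussSum_mulShift χ⁻¹ (-1)
  simp only [neg_neg, AddChar.mulShift_one] at h3
  simp only [h3] at h1
  have h4 := hp.fourierTransform_eq_inv_mul_gaussSum 1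
  rw [DirichletCharacter.fourierTransform_eq_gaussSum_mulShift] at h4
  have h5 := star_gaussSum_eq χ⁻¹ (ZMod.stdAddChar (N := D))
  rw [inv_inv, ← AddChar.inv_mulShift, h4] at *
  have h6 := congrArg norm h5
  rw [norm_star, norm_mul, hu, one_mul] at h6
  have h7 := congrArg norm h1
  simp only [norm_mul, smul_eq_mul, hu, mul_one, ← h6, Complex.norm_natCast] at h7
  rw [← h7, Real.sqrt_mul_self (norm_nonneg _)]

lemma zeta_lower (K : ℕ) (hK : 2 ≤ K) (he : Even K) :
    2 * ((K-1).factorial : ℝ) / (2*π)^K ≤ ‖riemannZeta (1 - (K:ℂ))‖ := by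
  have hz : 1 ≤ ‖riemannZeta (K:ℂ)‖ := by
    rw [zeta_nat_eq_tsum_of_gt_one (by omega)]
    have hs : Summable (fun n : ℕ => 1 / (n:ℝ)^K) := Real.summable_one_div_nat_pow.2 (by omega)
    have h := hs.le_tsum 1 (fun j _ => by positivity)
    have : (∑' n : ℕ, 1 / (n:ℂ)^K) = ((∑' n : ℕ, 1 / (n:ℝ)^K : ℝ) : ℂ) := by push_cast; rfl
    rw [this, Complex.norm_real]
    refine le_trans ?_ (le_abs_self _)
    simpa using h
  have hc : ‖Complex.cos (π * K / 2)‖ = 1 := by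
    obtain ⟨m, rfl⟩ := he
    have : (π * ((m + m : ℕ):ℂ) / 2) = ((m * π : ℝ):ℂ) := by push_cast; ring
    rw [this, ← Complex.ofReal_cos, Real.cos_nat_mul_pi]
    simp
  rw [riemannZeta_one_sub]
  · have hg : Complex.Gamma K = ((K-1).factorial : ℂ) := by
      have := Complex.Gamma_nat_eq_factorial (K-1)
      rw [← this]; congr 1; push_cast [Nat.cast_sub (show 1 ≤ K by omega)]; ring
    rw [hg, norm_mul, norm_mul, norm_mul, norm_mul, hc, Complex.norm_natCast, Complex.cpow_neg, Complex.cpow_natCast]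
    simp only [norm_inv, norm_pow, norm_mul, Complex.norm_real, Complex.norm_ofNat, Real.norm_eq_abs, abs_of_pos Real.pi_pos]
    rw [mul_one, div_eq_mul_inv]
    refine le_trans (le_of_eq (by ring)) (le_mul_of_one_le_right (by positivity) hz)
  · intro n h
    have := congrArg Complex.re h
    simp at this
    have h2 : (2:ℝ) ≤ K := by exact_mod_cast hK
    have : (0:ℝ) ≤ n := by positivity
    linarith
  · norm_cast; omega

lemma L_upper (D ℓ : ℕ) (hℓ : 3 ≤ ℓ) (χ : DirichletCharacter ℂ D) :
    ‖∑' n : ℕ+, (starRingEnd ℂ) (χ (((n:ℕ) : ℕ) : ZMod D)) / ((n : ℕ) : ℂ) ^ ℓ‖ ≤ π^2/6 := by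
  have hz := hasSum_zeta_two
  have hs : Summable (fun n : ℕ+ => 1 / ((n:ℕ):ℝ)^2) :=
    hz.summable.comp_injective PNat.coe_injective
  have h2 : ∑' n : ℕ+, 1 / ((n:ℕ):ℝ)^2 ≤ π^2/6 := by
    rw [← hz.tsum_eq]
    exact _root_.tsum_comp_le_tsum_of_inj hz.summable (fun _ => by positivity) PNat.coe_injective
  refine (tsum_of_norm_bounded hs.hasSum fun n => ?_).trans h2
  have hn : (1:ℝ) ≤ (n:ℕ) := by exact_mod_cast n.2
  rw [norm_div, norm_pow, Complex.norm_natCast, RCLike.norm_conj]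
  gcongr
  · exact χ.norm_le_one _
  · omega

lemma stirling_ratio (n m : ℕ) (hn : n ≠ 0) (hm : m ≠ 0) :
    Stirling.stirlingSeq n * (π^2/6) ≤ 2 * Stirling.stirlingSeq m := by
  have h1 : Stirling.stirlingSeq n ≤ Real.exp 1 / √2 := by
    rw [← Stirling.stirlingSeq_one]
    obtain ⟨k, rfl⟩ := Nat.exists_eq_succ_of_ne_zero hn
    exact Stirling.stirlingSeq'_antitone (Nat.zero_le k)
  have h2 := Stirling.sqrt_pi_le_stirlingSeq hm
  have h3 : Real.exp 1 / √2 ≤ 2 := by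
    rw [div_le_iff₀ (by positivity)]
    have := Real.exp_one_lt_d9
    have : (1.4:ℝ) ≤ √2 := Real.le_sqrt_of_sq_le (by norm_num)
    linarith
  have h4 : (1.75:ℝ) ≤ √π := Real.le_sqrt_of_sq_le (by have := Real.pi_gt_d2; norm_num at *; linarith)
  have h5 : π^2/6 ≤ 1.75 := by
    have := Real.pi_lt_d2
    have := Real.pi_pos
    nlinarith
  calc _ ≤ 2 * (1.75:ℝ) := by
        apply mul_le_mul (h1.trans h3) h5 (by positivity) (by norm_num)
    _ ≤ _ := by linarith

lemma factorial_stirling (n : ℕ) (hn : n ≠ 0) :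
    (n.factorial : ℝ) = Stirling.stirlingSeq n * (√2 * √n * (n / Real.exp 1)^n) := by
  have : (0:ℝ) < n := by positivity
  rw [Stirling.stirlingSeq, Real.sqrt_mul (by norm_num)]
  field_simp

lemma final_bound (n d D : ℕ) (hn : n ≠ 0) (hD : 1 ≤ D) :
    2 * ((n.factorial : ℝ) * (D:ℝ)^(n+1) * (π^2/6) / ((2*π)^(n+1) * √D))
      / (2 * ((n+d).factorial : ℝ) / (2*π)^(n+d+1))
    ≤ 2 * ((n:ℝ) * D / ((n+d : ℕ):ℝ)) ^ ((n:ℝ) + 1/2) * (2*π*Real.exp 1 / ((n+d:ℕ):ℝ))^d := by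
  have hm : n + d ≠ 0 := by omega
  have hs := stirling_ratio n (n+d) hn hm
  have hn0 : (0:ℝ) < n := by positivity
  have hD0 : (0:ℝ) < D := by positivity
  have hm0 : (0:ℝ) < ((n+d:ℕ):ℝ) := by positivity
  have hspos : 0 < Stirling.stirlingSeq (n+d) :=
    lt_of_lt_of_le (Real.sqrt_pos.2 Real.pi_pos) (Stirling.sqrt_pi_le_stirlingSeq hm)
  rw [factorial_stirling n hn, factorial_stirling (n+d) hm]
  rw [Real.rpow_add (by positivity), Real.rpow_natCast, ← Real.sqrt_eq_rpow,
    Real.sqrt_div (by positivity), Real.sqrt_mul (by positivity)]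
  generalize Stirling.stirlingSeq n = s at *
  generalize Stirling.stirlingSeq (n+d) = t at *
  generalize ((n+d:ℕ):ℝ) = m at *
  have hDs : (D:ℝ) = √D * √D := (Real.mul_self_sqrt hD0.le).symm
  have hsD : 0 < √(D:ℝ) := Real.sqrt_pos.2 hD0
  have hsn : 0 < √(n:ℝ) := Real.sqrt_pos.2 hn0
  have hsm : 0 < √m := Real.sqrt_pos.2 hm0
  have e1 : 2 * (s * (√2 * √(n:ℝ) * ((n:ℝ) / Real.exp 1)^n) * (D:ℝ)^(n+1) * (π^2/6)
      / ((2*π)^(n+1) * √D)) / (2 * (t * (√2 * √m * (m / Real.exp 1)^(n+d))) / (2*π)^(n+d+1))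
      = (s * (π^2/6)) * ((√n * √D / √m) * (n * D / m)^n * (2*π*Real.exp 1/m)^d / t) := by
    have hDD : (D:ℝ)^(n+1) = (D:ℝ)^n * (√D * √D) := by rw [← hDs, pow_succ]
    rw [hDD]
    simp only [div_pow, mul_pow, pow_add, pow_one]
    field_simp
  rw [e1]
  have e2 : 2 * (((n:ℝ) * D / m)^n * (√n * √D / √m)) * (2*π*Real.exp 1/m)^d
      = (2 * t) * ((√n * √D / √m) * (n * D / m)^n * (2*π*Real.exp 1/m)^d / t) := by
    field_simp
  rw [e2]
  exact mul_le_mul_of_nonneg_right hs (by positivity)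

/-- For even `K`, `3 ≤ ℓ ≤ (K−2)/2`, `D ≥ 1` odd square-free and `χ` primitive mod `D`,
`|2σ_{ℓ−1,χ}(0)/ζ(1−K)| ≤ 2 ((ℓ−1)D/(K−1))^{ℓ−1/2} (2πe/(K−1))^{K−ℓ}`. -/
theorem sigma_zero_over_zeta_bound (K ℓ D : ℕ) (hKeven : Even K) (hℓ : 3 ≤ ℓ)
    (hℓK : 2 * ℓ ≤ K - 2) (hD : 1 ≤ D) (hodd : Odd D) (hsf : Squarefree D)
    (χ : DirichletCharacter ℂ D) (hprim : χ.IsPrimitive) :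
    ‖2 * sigmaZero D ℓ (fun m => (starRingEnd ℂ) (χ ((m : ℕ) : ZMod D)))
        / riemannZeta (1 - (K : ℂ))‖
      ≤ 2 * (((ℓ : ℝ) - 1) * D / ((K : ℝ) - 1)) ^ ((ℓ : ℝ) - 1 / 2)
          * (2 * π * Real.exp 1 / ((K : ℝ) - 1)) ^ (K - ℓ) := by
  have : NeZero D := ⟨by omega⟩
  obtain ⟨n, rfl⟩ : ∃ n, ℓ = n + 1 := ⟨ℓ - 1, by omega⟩
  obtain ⟨d, rfl⟩ : ∃ d, K = n + d + 1 := ⟨K - n - 1, by omega⟩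
  have hD0 : (0:ℝ) < D := by positivity
  have hz := zeta_lower (n+d+1) (by omega) hKeven
  have hL := L_upper D (n+1) hℓ χ
  have hf := final_bound n d D (by omega) hD
  have r1 : (((n+1:ℕ):ℝ) - 1) = n := by push_cast; ring
  have r2 : (((n+d+1:ℕ):ℝ) - 1) = ((n+d:ℕ):ℝ) := by push_cast; ring
  have r3 : (((n+1:ℕ):ℝ) - 1/2) = (n:ℝ) + 1/2 := by push_cast; ring
  have r4 : n + d + 1 - (n + 1) = d := by omega
  rw [r1, r2, r3, r4]
  refine le_trans ?_ hf
  rw [norm_div, norm_mul, Complex.norm_ofNat, sigmaZero, gauss_eq, norm_div, norm_mul, norm_mul,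
    norm_mul, gauss_norm D χ hprim, norm_pow, norm_pow, norm_neg, norm_mul, norm_mul,
    Complex.norm_natCast, Complex.norm_natCast, Complex.norm_I, Complex.norm_real,
    Complex.norm_ofNat, Real.norm_eq_abs, abs_of_pos Real.pi_pos, mul_one]
  simp only [Nat.add_sub_cancel] at hz ⊢
  have hsD : 0 < √(D:ℝ) := Real.sqrt_pos.2 hD0
  gcongr
end

section
/- Let p > 2 be prime and χ a primitive quadratic or general Dirichlet character mod p with χ(−1) = −1. Then ∑_{n=1}^{p} σ_{2,𝟙,χ̄}(n) σ_{2,𝟙,χ}(p−n) = −B_{3,χ̄}/6 − B_{3,χ}/6 + B_{3,χ̄}B_{3,χ}/(3B₆), where σ_{k−1,𝟙,χ}(n) = ∑_{d₁d₂=n, d₁,d₂>0} χ(d₂) d₁^{k−1} for n ≥ 1 and σ_{k−1,𝟙,χ}(0) = 0 (for χ nontrivial), with the convention that the term n = p contributes σ_{2,𝟙,χ̄}(p)·σ_{2,𝟙,χ}(0) = 0, B_{n,χ} the generalized Bernoulli numbers defined by ∑_{a=1}^p χ(a) t e^{at}/(e^{pt}−1) = ∑_{n≥0} B_{n,χ}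 t^n/n!, and B₆ the ordinary 6th Bernoulli number. -/
/-- `σ_{k,𝟙,f}(n) = ∑_{d₁d₂ = n} f(d₂) d₁^k` (equal to `0` for `n = 0`). -/
noncomputable def sigmaTw (k : ℕ) (f : ℕ → ℂ) (n : ℕ) : ℂ :=
  ∑ d ∈ n.divisors, f (n / d) * (d : ℂ) ^ k

/-- The generalized Bernoulli number `B_{n,f}` for a character `f` mod `p`, given by the
standard closed formula `B_{n,f} = p^{n−1} ∑_{a mod p} f(a) B_n(a/p)` (equivalent to the
generating-function definition `∑_a f(a) t e^{at}/(e^{pt}−1) = ∑ B_{n,f} tⁿ/n!`). -/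
noncomputable def bernoulliChar (p : ℕ) (f : ℕ → ℂ) (n : ℕ) : ℂ :=
  (p : ℂ) ^ (n - 1) *
    ∑ a ∈ Finset.range p, f a * Polynomial.aeval ((a : ℂ) / p) (Polynomial.bernoulli n)

section TwHelpers

open UpperHalfPlane hiding I
open ModularForm EisensteinSeries Complex Real Filter Topology
open scoped MatrixGroups Manifold CongruenceSubgroup


theorem tw_mdiff (p : ℕ) [NeZero p] (F : ℍ → ℂ) (c : ℕ → ℂ)
    (hF : ∀ τ : ℍ, HasSum (fun m ↦ c m • Function.Periodic.qParam (p : ℝ) τ ^ m) (F τ)) :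
    MDiff F := by
  have hp : (0 : ℝ) < p := by exact_mod_cast NeZero.pos p
  set P := FormalMultilinearSeries.ofScalars ℂ c with hP
  have hsum : ∀ q : ℂ, ‖q‖ < 1 → q ≠ 0 → Summable fun m ↦ c m * q ^ m := by
    intro q hq hq0
    have h1 := Function.Periodic.im_invQParam_pos_of_norm_lt_one hp hq hq0
    have h2 := (hF ⟨Function.Periodic.invQParam p q, h1⟩).summable
    have h3 : Function.Periodic.qParam (p : ℝ) (Function.Periodic.invQParam p q) = q :=
      Function.Periodic.qParam_right_inv hp.ne' hq0
    simpa [h3] using h2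
  have hrad : 1 ≤ P.radius := by
    refine ENNReal.le_of_forall_nnreal_lt fun r hr => ?_
    have hr1 : (r : ℝ) < 1 := by exact_mod_cast hr
    by_cases hr0 : r = 0
    · simp [hr0]
    refine P.le_radius_of_tendsto (l := 0) ?_
    have := (hsum (r : ℂ) (by simpa using hr1) (by simpa using hr0)).tendsto_atTop_zero.norm
    simpa [hP] using this
  have hfps : HasFPowerSeriesOnBall P.sum P 0 1 :=
    (P.hasFPowerSeriesOnBall (lt_of_lt_of_le one_pos hrad)).mono one_pos hrad
  have hdiff : DifferentiableOn ℂ P.sum (Metric.eball 0 1) := hfps.differentiableOn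
  rw [UpperHalfPlane.mdifferentiable_iff]
  have : DifferentiableOn ℂ (fun z : ℂ => P.sum (Function.Periodic.qParam (p : ℝ) z)) {z | 0 < z.im} := by
    refine hdiff.comp (Function.Periodic.differentiable_qParam.differentiableOn) ?_
    intro z hz
    have := Function.Periodic.norm_qParam_lt_one hp (z := z) hz
    have h2 : ‖Function.Periodic.qParam (p : ℝ) z‖₊ < 1 := by exact_mod_cast this
    simpa [Metric.mem_eball, edist_zero_right, enorm] using h2
  refine this.congr fun z hz => ?_
  have h1 := hF ⟨z, hz⟩
  simp only [Function.comp, UpperHalfPlane.ofComplex_apply_of_im_pos hz]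
  rw [← h1.tsum_eq, FormalMultilinearSeries.sum]
  refine tsum_congr fun m => ?_
  simp [hP, mul_comm]

theorem tw_key (p : ℕ) [NeZero p] (F : ℍ → ℂ) (c : ℕ → ℂ)
    (hinv : ∀ γ : SL(2, ℤ), F ∣[(6 : ℤ)] γ = F)
    (hF : ∀ τ : ℍ, HasSum (fun m ↦ c m • Function.Periodic.qParam (p : ℝ) τ ^ m) (F τ)) :
    c p = -504 * c 0 := by
  have hp : (0 : ℝ) < p := by exact_mod_cast NeZero.pos p
  let f : ModularForm 𝒮ℒ 6 :=
    { toFun := F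
      slash_action_eq' := by
        rintro A ⟨γ, rfl⟩
        exact hinv γ
      holo' := tw_mdiff p F c hF
      bdd_at_cusps' := by
        intro d hd
        rw [OnePoint.isBoundedAt_iff_forall_SL2Z hd]
        intro γ _
        rw [hinv γ]
        exact isBoundedAtImInfty_of_hasSum_qExpansion hp hF }
  have hE0 : E₆ ≠ 0 := E_ne_zero _ ⟨3, rfl⟩
  obtain ⟨b, hb⟩ := (finrank_eq_one_iff_of_nonzero' E₆ hE0).mp
    (Module.rank_eq_one_iff_finrank_eq_one.mp levelOne_weight_six_rank_one) f
  have hper : (p : ℝ) ∈ (𝒮ℒ : Subgroup (GL (Fin 2) ℝ)).strictPeriods := by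
    have := AddSubgroup.nsmul_mem _ one_mem_strictPeriods_SL p
    simpa using this
  -- expansion of E₆ in the variable of width p
  set ε : ℕ → ℂ := fun m => (qExpansion 1 E₆).coeff m with hε
  have hE : ∀ τ : ℍ, HasSum (fun m : ℕ ↦ (if p ∣ m then b * ε (m / p) else 0) •
      Function.Periodic.qParam (p : ℝ) τ ^ m) (f τ) := by
    intro τ
    have h1 := (ModularForm.hasSum_qExpansion (f := E₆) one_pos
      one_mem_strictPeriods_SL τ).mul_left b
    have hfb : f τ = b * E₆ τ := by rw [← hb]; rfl
    rw [hfb]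
    have hinj : Function.Injective (fun m : ℕ => p * m) :=
      fun x y h => Nat.eq_of_mul_eq_mul_left (NeZero.pos p) h
    rw [← hinj.hasSum_iff]
    · convert! h1 using 1
      ext m
      have : Function.Periodic.qParam (p : ℝ) τ ^ p = Function.Periodic.qParam (1 : ℝ) τ := by
        simp only [Function.Periodic.qParam]
        rw [← Complex.exp_nat_mul]
        congr 1
        have : (p : ℂ) ≠ 0 := by exact_mod_cast NeZero.ne p
        push_cast
        field_simp
      simp [hε, pow_mul, this, Nat.mul_div_cancel_left _ (NeZero.pos p), mul_assoc]
    · intro m hm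
      have : ¬ p ∣ m := fun ⟨d, hd⟩ => hm ⟨d, hd.symm⟩
      simp [this]
  have hu1 : ∀ m, c m = (qExpansion p f).coeff m := fun m =>
    ModularFormClass.qExpansion_coeff_unique (f := f) hp hper hF m
  have hu2 : ∀ m, (if p ∣ m then b * ε (m / p) else 0) = (qExpansion p f).coeff m := fun m =>
    ModularFormClass.qExpansion_coeff_unique (f := f) hp hper hE m
  have e0 : ε 0 = 1 := E_qExpansion_coeff_zero _ ⟨3, rfl⟩
  have e1 : ε 1 = -504 := E₆_qExpansion_coeff_one
  rw [hu1 p, hu1 0, ← hu2, ← hu2]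
  simp [Nat.div_self (NeZero.pos p), e0, e1, mul_comm]


/-- The normalising constant `(-2πi)³/p³`. -/
noncomputable def twC (p : ℕ) : ℂ := (-2 * π * I) ^ 3 / (p : ℂ) ^ 3

/-- Residue class decomposition of `ℤ`. -/
noncomputable def twEquiv (p : ℕ) [NeZero p] : ZMod p × ℤ ≃ ℤ where
  toFun x := (x.1.val : ℤ) + p * x.2
  invFun d := ((d : ZMod p), d / p)
  left_inv := by
    rintro ⟨s, m⟩
    have hp : (0 : ℤ) < p := by exact_mod_cast NeZero.pos p
    have h1 : (s.val : ℤ) < p := by exact_mod_cast s.val_lt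
    simp only [Prod.mk.injEq]
    refine ⟨by simp, ?_⟩
    rw [Int.add_mul_ediv_left _ _ hp.ne', Int.ediv_eq_zero_of_lt (by positivity) h1, zero_add]
  right_inv := by
    intro d
    simp only [ZMod.val_intCast]
    exact Int.emod_add_mul_ediv d p

theorem twEquiv_apply (p : ℕ) [NeZero p] (s : ZMod p) (m : ℤ) :
    twEquiv p (s, m) = (s.val : ℤ) + p * m := rfl

theorem tw_lipschitz (p : ℕ) [NeZero p] (φ : ZMod p → ℂ) (τ : ℍ)
    (hs : Summable fun d : ℤ => φ d * ((τ : ℂ) + d) ^ (-3 : ℤ)) :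
    ∑' d : ℤ, φ d * ((τ : ℂ) + d) ^ (-3 : ℤ) =
      twC p / 2 * ∑' n : ℕ+, ((n : ℕ) : ℂ) ^ 2 *
        (∑ s : ZMod p, φ s * ZMod.stdAddChar (s * ((n : ℕ) : ZMod p))) *
          cexp (2 * π * I * τ / p) ^ (n : ℕ) := by
  have hp : (p : ℂ) ≠ 0 := by exact_mod_cast NeZero.ne p
  have hp' : (0 : ℝ) < p := by exact_mod_cast NeZero.pos p
  have hs' : Summable fun x : ZMod p × ℤ => φ ((twEquiv p x : ℤ) : ZMod p) *
      ((τ : ℂ) + (twEquiv p x : ℤ)) ^ (-3 : ℤ) := hs.comp_injective (twEquiv p).injective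
  rw [← (twEquiv p).tsum_eq, Summable.tsum_prod hs', tsum_fintype]
  have hin : ∀ s : ZMod p, 0 < (((τ : ℂ) + s.val) / p).im := by
    intro s
    have : (((τ : ℂ) + s.val) / p) = (((p : ℝ)⁻¹ : ℝ) : ℂ) * ((τ : ℂ) + s.val) := by
      push_cast; field_simp
    rw [this, Complex.im_ofReal_mul]
    have h2 : ((τ : ℂ) + s.val).im = τ.im := by
      rw [Complex.add_im, Complex.natCast_im, add_zero]; rfl
    rw [h2]
    exact mul_pos (inv_pos.2 hp') τ.im_pos
  have hexp : ∀ s : ZMod p, cexp (2 * π * I * (((τ : ℂ) + s.val) / p)) =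
      ZMod.stdAddChar s * cexp (2 * π * I * τ / p) := by
    intro s
    have h1 := ZMod.stdAddChar_coe (N := p) (s.val : ℤ)
    rw [Int.cast_natCast, ZMod.natCast_zmod_val] at h1
    rw [h1, ← Complex.exp_add]
    congr 1
    push_cast
    ring
  have hsum : ∀ s : ZMod p, Summable fun n : ℕ+ => ((n : ℕ) : ℂ) ^ 2 *
      (φ s * ZMod.stdAddChar (s * ((n : ℕ) : ZMod p))) * cexp (2 * π * I * τ / p) ^ (n : ℕ) := by
    intro s
    have h := summable_pow_mul_cexp 2 1 ⟨((τ : ℂ) + s.val) / p, hin s⟩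
    have h2 := (h.comp_injective PNat.coe_injective).mul_left (φ s)
    refine h2.congr fun n => ?_
    simp only [Function.comp, PNat.one_coe, Nat.cast_one, mul_one, hexp]
    rw [mul_comm s, ← nsmul_eq_mul, AddChar.map_nsmul_eq_pow, mul_pow]
    ring
  have hrow : ∀ s : ZMod p, ∑' m : ℤ, φ ((twEquiv p (s, m) : ℤ) : ZMod p) *
      ((τ : ℂ) + (twEquiv p (s, m) : ℤ)) ^ (-3 : ℤ) = twC p / 2 * ∑' n : ℕ+, ((n : ℕ) : ℂ) ^ 2 *
      (φ s * ZMod.stdAddChar (s * ((n : ℕ) : ZMod p))) * cexp (2 * π * I * τ / p) ^ (n : ℕ) := by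
    intro s
    have h := qExpansion_identity_pnat (k := 2) (by norm_num) ⟨((τ : ℂ) + s.val) / p, hin s⟩
    simp only [hexp] at h
    have e1 : ∀ m : ℤ, φ ((twEquiv p (s, m) : ℤ) : ZMod p) *
      ((τ : ℂ) + (twEquiv p (s, m) : ℤ)) ^ (-3 : ℤ) =
        (φ s / (p : ℂ) ^ 3) * (1 / (((τ : ℂ) + s.val) / p + m) ^ (2 + 1)) := by
      intro m
      have h3 : ((twEquiv p (s, m) : ℤ) : ZMod p) = s := by rw [twEquiv_apply]; simp
      rw [h3]
      have h4 : (τ : ℂ) + (twEquiv p (s, m) : ℤ) = p * (((τ : ℂ) + s.val) / p + m) := by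
        rw [twEquiv_apply]; push_cast; field_simp; ring
      rw [h4, zpow_neg, mul_zpow, mul_inv]
      norm_cast
      simp [div_eq_mul_inv, mul_assoc]
    rw [tsum_congr e1, tsum_mul_left, h]
    simp only [← tsum_mul_left]
    refine tsum_congr fun n => ?_
    rw [mul_comm s, ← nsmul_eq_mul, AddChar.map_nsmul_eq_pow, mul_pow, twC]
    rw [Nat.factorial_two]
    generalize cexp (2 * π * I * τ / p) = w
    push_cast
    ring
  rw [Finset.sum_congr rfl fun s _ => hrow s, ← Finset.mul_sum,
    ← Summable.tsum_finsetSum fun s _ => hsum s]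
  congr 1
  refine tsum_congr fun n => ?_
  simp only [Finset.mul_sum, Finset.sum_mul]


theorem tw_lambert (b : ℕ → ℕ → ℂ) (M : ℝ) (hb : ∀ m n, ‖b m n‖ ≤ M) (w : ℂ) (hw : ‖w‖ < 1) :
    HasSum (fun N : ℕ => (∑ x ∈ N.divisorsAntidiagonal, (x.2 : ℂ) ^ 2 * b x.1 x.2) * w ^ N)
      (∑' m : ℕ+, ∑' n : ℕ+, ((n : ℕ) : ℂ) ^ 2 * b m n * w ^ ((m : ℕ) * (n : ℕ))) := by
  have hS : Summable fun c : ℕ+ × ℕ+ =>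
      ((c.2 : ℕ) : ℂ) ^ 2 * b c.1 c.2 * w ^ ((c.1 : ℕ) * (c.2 : ℕ)) := by
    refine Summable.of_norm_bounded ((summable_prod_mul_pow 2 hw).norm.mul_left M) fun c => ?_
    simp only [norm_mul]
    have := hb c.1 c.2
    have h0 : 0 ≤ ‖((c.2 : ℕ) : ℂ) ^ 2‖ * ‖w ^ ((c.1 : ℕ) * (c.2 : ℕ))‖ := by positivity
    nlinarith [mul_le_mul_of_nonneg_right this h0]
  rw [← hS.tsum_prod]
  have h1 := hS.hasSum
  rw [← sigmaAntidiagonalEquivProd.hasSum_iff] at h1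
  have h2 := h1.sigma (fun n => hasSum_fintype _)
  rw [← PNat.coe_injective.hasSum_iff]
  · convert h2 using 1
    ext N
    simp only [Function.comp, sigmaAntidiagonalEquivProd, divisorsAntidiagonalFactors,
      Equiv.coe_fn_mk, PNat.mk_coe, Finset.univ_eq_attach]
    rw [(N : ℕ).divisorsAntidiagonal.sum_attach
      (fun x : ℕ × ℕ => (x.2 : ℂ) ^ 2 * b x.1 x.2 * w ^ (x.1 * x.2)), Finset.sum_mul]
    refine Finset.sum_congr rfl fun x hx => ?_
    rw [(Nat.mem_divisorsAntidiagonal.mp hx).1]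
  · intro N hN
    have : N = 0 := by
      by_contra h
      exact hN ⟨⟨N, Nat.pos_of_ne_zero h⟩, rfl⟩
    simp [this]

/-- Weight three Eisenstein series attached to a function modulo `p`. -/
noncomputable def twG (p : ℕ) (Φ : (Fin 2 → ZMod p) → ℂ) (z : ℍ) : ℂ :=
  ∑' v : Fin 2 → ℤ, Φ (fun i => (v i : ZMod p)) * eisSummand 3 v z

/-- The coefficients of `twG`. -/
noncomputable def twg (p : ℕ) [NeZero p] (Φ : (Fin 2 → ZMod p) → ℂ) (N : ℕ) : ℂ :=
  if N = 0 then ∑' d : ℤ, Φ ![0, (d : ZMod p)] * (d : ℂ) ^ (-3 : ℤ) else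
    twC p * ∑ x ∈ N.divisorsAntidiagonal, (x.2 : ℂ) ^ 2 *
      ∑ s : ZMod p, Φ ![(x.1 : ZMod p), s] * ZMod.stdAddChar (s * (x.2 : ZMod p))

theorem twG_summable (p : ℕ) [NeZero p] (Φ : (Fin 2 → ZMod p) → ℂ) (z : ℍ) :
    Summable fun v : Fin 2 → ℤ => Φ (fun i => (v i : ZMod p)) * eisSummand 3 v z := by
  refine Summable.of_norm_bounded
    ((summable_norm_eisSummand (k := 3) (by norm_num) z).mul_left (∑ v, ‖Φ v‖)) fun v => ?_
  rw [norm_mul]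
  gcongr
  exact Finset.single_le_sum (f := fun v => ‖Φ v‖) (fun _ _ => norm_nonneg _) (Finset.mem_univ _)

theorem twG_hasSum (p : ℕ) [NeZero p] (Φ : (Fin 2 → ZMod p) → ℂ) (hΦ : ∀ v, Φ (-v) = - Φ v)
    (z : ℍ) :
    HasSum (fun N : ℕ => twg p Φ N * Function.Periodic.qParam (p : ℝ) z ^ N) (twG p Φ z) := by
  have hp' : (0 : ℝ) < p := by exact_mod_cast NeZero.pos p
  set w : ℂ := Function.Periodic.qParam (p : ℝ) z with hw
  have hw1 : ‖w‖ < 1 := Function.Periodic.norm_qParam_lt_one hp' z.im_pos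
  have hwe : w = cexp (2 * π * I * z / p) := by
    simp [hw, Function.Periodic.qParam]
  have hS0 : Summable fun x : ℤ × ℤ =>
      Φ ![(x.1 : ZMod p), (x.2 : ZMod p)] * ((x.1 : ℂ) * z + x.2) ^ (-3 : ℤ) := by
    have h := (twG_summable p Φ z).comp_injective (finTwoArrowEquiv ℤ).symm.injective
    refine h.congr fun x => ?_
    simp only [Function.comp, finTwoArrowEquiv_symm_apply, eisSummand]
    congr 2
    ext i
    fin_cases i <;> rfl
  have hG : twG p Φ z = ∑' c : ℤ, ∑' d : ℤ,
      Φ ![(c : ZMod p), (d : ZMod p)] * ((c : ℂ) * z + d) ^ (-3 : ℤ) := by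
    rw [← hS0.tsum_prod, twG, ← (finTwoArrowEquiv ℤ).symm.tsum_eq]
    refine tsum_congr fun x => ?_
    simp only [finTwoArrowEquiv_symm_apply, eisSummand]
    congr 2
    ext i
    fin_cases i <;> rfl
  rw [tsum_int_eq_zero_add_two_mul_tsum_pnat (fun c ↦ ?h₁) hS0.prod] at hG
  case h₁ =>
    rw [← tsum_comp_neg]
    refine tsum_congr fun d => ?_
    have h1 : Φ ![((-c : ℤ) : ZMod p), ((-d : ℤ) : ZMod p)] =
        - Φ ![(c : ZMod p), (d : ZMod p)] := by
      rw [← hΦ]; simp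
    have h2 : (((-c : ℤ) : ℂ) * z + ((-d : ℤ) : ℂ)) = -((c : ℂ) * z + d) := by
      push_cast; ring
    rw [h1, h2, Odd.neg_zpow (by decide)]
    ring
  have hrow : ∀ c : ℕ+, ∑' d : ℤ, Φ ![(((c : ℕ) : ℤ) : ZMod p), (d : ZMod p)] *
      ((((c : ℕ) : ℤ) : ℂ) * z + d) ^ (-3 : ℤ) = twC p / 2 * ∑' n : ℕ+, ((n : ℕ) : ℂ) ^ 2 *
        (∑ s : ZMod p, Φ ![((c : ℕ) : ZMod p), s] * ZMod.stdAddChar (s * ((n : ℕ) : ZMod p))) *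
          w ^ ((c : ℕ) * (n : ℕ)) := by
    intro c
    have him : 0 < (((c : ℕ) : ℂ) * z).im := by
      simpa using z.2
    have hs := hS0.prod_factor ((c : ℕ) : ℤ)
    have := tw_lipschitz p (fun s => Φ ![((c : ℕ) : ZMod p), s]) ⟨((c : ℕ) : ℂ) * z, him⟩
      (by simpa using hs)
    have he : cexp (2 * π * I * (((c : ℕ) : ℂ) * z) / p) = w ^ (c : ℕ) := by
      rw [hwe, ← Complex.exp_nat_mul]; congr 1; ring
    simp only [he] at this
    simp only [pow_mul]
    simpa using this
  have hl := tw_lambert (fun m n => ∑ s : ZMod p, Φ ![(m : ZMod p), s] *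
    ZMod.stdAddChar (s * (n : ZMod p))) (∑ s : ZMod p, ∑ v, ‖Φ v‖) (fun m n => by
      refine (norm_sum_le _ _).trans (Finset.sum_le_sum fun s _ => ?_)
      rw [norm_mul, AddChar.norm_apply, mul_one]
      exact Finset.single_le_sum (f := fun v => ‖Φ v‖) (fun _ _ => norm_nonneg _)
        (Finset.mem_univ _)) w hw1
  have hl2 := (hl.mul_left (twC p)).add
    (hasSum_ite_eq (0 : ℕ) (∑' d : ℤ, Φ ![0, (d : ZMod p)] * (d : ℂ) ^ (-3 : ℤ)))
  have e2 : twG p Φ z = twC p * (∑' m : ℕ+, ∑' n : ℕ+, ((n : ℕ) : ℂ) ^ 2 *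
      (∑ s : ZMod p, Φ ![((m : ℕ) : ZMod p), s] * ZMod.stdAddChar (s * ((n : ℕ) : ZMod p))) *
        w ^ ((m : ℕ) * (n : ℕ))) + ∑' d : ℤ, Φ ![0, (d : ZMod p)] * (d : ℂ) ^ (-3 : ℤ) := by
    rw [hG]
    dsimp only
    rw [tsum_congr hrow, tsum_mul_left, add_comm]
    congr 1
    · rw [two_nsmul]; ring
    · refine tsum_congr fun d => ?_
      simp
  rw [e2]
  refine hl2.congr_fun fun N => ?_
  by_cases hN : N = 0
  · simp [twg, hN]
  · simp [twg, hN, mul_assoc]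

/-- Reduction of an integral matrix modulo `p`. -/
def twR (p : ℕ) (γ : SL(2, ℤ)) : Matrix.SpecialLinearGroup (Fin 2) (ZMod p) :=
  Matrix.SpecialLinearGroup.map (Int.castRingHom (ZMod p)) γ

theorem twR_vecMul (p : ℕ) (γ : SL(2, ℤ)) (v : Fin 2 → ℤ) :
    (fun i => ((Matrix.vecMul v (γ : Matrix (Fin 2) (Fin 2) ℤ) i : ℤ) : ZMod p)) =
      Matrix.vecMul (fun i => (v i : ZMod p)) (twR p γ : Matrix (Fin 2) (Fin 2) (ZMod p)) := by
  ext i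
  simp [twR, Matrix.vecMul, Matrix.vec2_dotProduct]

/-- Right multiplication by a special linear matrix, as a permutation of row vectors. -/
def twPerm {R : Type*} [CommRing R] (A : Matrix.SpecialLinearGroup (Fin 2) R) :
    (Fin 2 → R) ≃ (Fin 2 → R) where
  toFun v := Matrix.vecMul v (A : Matrix (Fin 2) (Fin 2) R)
  invFun v := Matrix.vecMul v ((A⁻¹ : Matrix.SpecialLinearGroup (Fin 2) R) :
    Matrix (Fin 2) (Fin 2) R)
  left_inv v := by
    dsimp only
    rw [Matrix.vecMul_vecMul, ← Matrix.SpecialLinearGroup.coe_mul, mul_inv_cancel,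
      Matrix.SpecialLinearGroup.coe_one, Matrix.vecMul_one]
  right_inv v := by
    dsimp only
    rw [Matrix.vecMul_vecMul, ← Matrix.SpecialLinearGroup.coe_mul, inv_mul_cancel,
      Matrix.SpecialLinearGroup.coe_one, Matrix.vecMul_one]

/-- The function `v ↦ ∑ ψ(t)` over `t` with `v = t a`. -/
noncomputable def twPhi (p : ℕ) [NeZero p] (ψ : DirichletCharacter ℂ p) (a v : Fin 2 → ZMod p) :
    ℂ :=
  ∑ t : ZMod p, ψ t * if v = t • a then 1 else 0

theorem twPhi_perm (p : ℕ) [NeZero p] (ψ : DirichletCharacter ℂ p) (a v : Fin 2 → ZMod p)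
    (A : Matrix.SpecialLinearGroup (Fin 2) (ZMod p)) :
    twPhi p ψ (twPerm A a) (twPerm A v) = twPhi p ψ a v := by
  refine Finset.sum_congr rfl fun t _ => ?_
  have : t • twPerm A a = twPerm A (t • a) := by
    simp [twPerm, Matrix.smul_vecMul]
  rw [this]
  simp only [(twPerm A).injective.eq_iff]

theorem twPhi_neg (p : ℕ) [NeZero p] (ψ : DirichletCharacter ℂ p) (hψ : ψ (-1) = -1)
    (a v : Fin 2 → ZMod p) : twPhi p ψ a (-v) = - twPhi p ψ a v := by
  rw [twPhi, twPhi, ← Fintype.sum_equiv (Equiv.neg (ZMod p)) _ _ fun t => rfl,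
    ← Finset.sum_neg_distrib]
  refine Finset.sum_congr rfl fun t _ => ?_
  have h1 : ψ (-t) = - ψ t := by rw [← neg_one_mul, map_mul, hψ, neg_one_mul]
  rw [Equiv.neg_apply, h1, _root_.neg_smul]
  simp only [neg_inj, neg_mul]

theorem twG_slash (p : ℕ) [NeZero p] (ψ : DirichletCharacter ℂ p) (a : Fin 2 → ZMod p)
    (γ : SL(2, ℤ)) :
    twG p (twPhi p ψ a) ∣[(3 : ℤ)] γ = twG p (twPhi p ψ (twPerm (twR p γ) a)) := by
  ext1 z
  simp_rw [SL_slash_apply, zpow_neg,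
    mul_inv_eq_iff_eq_mul₀ (zpow_ne_zero _ <| denom_ne_zero _ z), twG, eisSummand_SL2_apply]
  rw [← (twPerm γ).tsum_eq (fun v : Fin 2 → ℤ => twPhi p ψ (twPerm (twR p γ) a)
    (fun i => (v i : ZMod p)) * eisSummand 3 v z), ← tsum_mul_right]
  refine tsum_congr fun v => ?_
  have h : (fun i => ((twPerm γ v i : ℤ) : ZMod p)) =
      twPerm (twR p γ) (fun i => (v i : ZMod p)) := twR_vecMul p γ v
  rw [h, twPhi_perm]
  change twPhi p ψ a _ * (_ * eisSummand 3 (twPerm γ v) z) = _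
  ring

/-- The weight six form. -/
noncomputable def twF (p : ℕ) [NeZero p] (χ : DirichletCharacter ℂ p) : ℍ → ℂ :=
  ∑ a : Fin 2 → ZMod p, twG p (twPhi p χ a) * twG p (twPhi p χ⁻¹ a)

theorem twF_slash (p : ℕ) [NeZero p] (χ : DirichletCharacter ℂ p) (γ : SL(2, ℤ)) :
    twF p χ ∣[(6 : ℤ)] γ = twF p χ := by
  have hs : ∀ (s : Finset (Fin 2 → ZMod p)) (f : (Fin 2 → ZMod p) → ℍ → ℂ),
      (∑ a ∈ s, f a) ∣[(6 : ℤ)] γ = ∑ a ∈ s, f a ∣[(6 : ℤ)] γ := by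
    intro s f
    induction s using Finset.induction_on with
    | empty => simp
    | insert a s ha ih => rw [Finset.sum_insert ha, Finset.sum_insert ha, SlashAction.add_slash, ih]
  have hm : ∀ f g : ℍ → ℂ, (f * g) ∣[(6 : ℤ)] γ = f ∣[(3 : ℤ)] γ * g ∣[(3 : ℤ)] γ := fun f g =>
    mul_slash_SL2 3 3 γ f g
  rw [twF, hs]
  simp only [hm, twG_slash]
  exact (twPerm (twR p γ)).sum_comp (fun a => twG p (twPhi p χ a) * twG p (twPhi p χ⁻¹ a))

/-- Coefficients of `twF`. -/
noncomputable def twf (p : ℕ) [NeZero p] (χ : DirichletCharacter ℂ p) (N : ℕ) : ℂ :=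
  ∑ a : Fin 2 → ZMod p, ∑ x ∈ Finset.HasAntidiagonal.antidiagonal N,
    twg p (twPhi p χ a) x.1 * twg p (twPhi p χ⁻¹ a) x.2

theorem twF_hasSum (p : ℕ) [NeZero p] (χ : DirichletCharacter ℂ p) (hχ : χ (-1) = -1)
    (hχ' : χ⁻¹ (-1) = -1) (z : ℍ) :
    HasSum (fun N : ℕ => twf p χ N • Function.Periodic.qParam (p : ℝ) z ^ N) (twF p χ z) := by
  have h : ∀ a : Fin 2 → ZMod p, HasSum (fun N : ℕ => (∑ x ∈ Finset.HasAntidiagonal.antidiagonal N,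
      twg p (twPhi p χ a) x.1 * twg p (twPhi p χ⁻¹ a) x.2) *
        Function.Periodic.qParam (p : ℝ) z ^ N)
      ((twG p (twPhi p χ a) * twG p (twPhi p χ⁻¹ a)) z) := by
    intro a
    have h1 := twG_hasSum p (twPhi p χ a) (twPhi_neg p χ hχ a) z
    have h2 := twG_hasSum p (twPhi p χ⁻¹ a) (twPhi_neg p χ⁻¹ hχ' a) z
    rw [Pi.mul_apply, ← h1.tsum_eq, ← h2.tsum_eq,
      tsum_mul_tsum_eq_tsum_sum_antidiagonal_of_summable_norm h1.summable.norm h2.summable.norm]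
    have h3 := (summable_norm_sum_mul_antidiagonal_of_summable_norm
      h1.summable.norm h2.summable.norm).of_norm.hasSum
    refine h3.congr_fun fun N => ?_
    rw [Finset.sum_mul]
    refine Finset.sum_congr rfl fun x hx => ?_
    rw [← Finset.HasAntidiagonal.mem_antidiagonal.mp hx, pow_add]
    ring
  have h4 := hasSum_sum (s := Finset.univ) (fun a _ => h a)
  rw [twF, Finset.sum_apply]
  refine h4.congr_fun fun N => ?_
  rw [twf, smul_eq_mul, Finset.sum_mul]

theorem twf_key (p : ℕ) [NeZero p] (χ : DirichletCharacter ℂ p) (hχ : χ (-1) = -1)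
    (hχ' : χ⁻¹ (-1) = -1) : twf p χ p = -504 * twf p χ 0 :=
  tw_key p (twF p χ) (twf p χ) (twF_slash p χ) (twF_hasSum p χ hχ hχ')

/-- The two-sided `L`-value at `3`. -/
noncomputable def twL (p : ℕ) (ψ : DirichletCharacter ℂ p) : ℂ :=
  ∑' d : ℤ, ψ (d : ZMod p) * (d : ℂ) ^ (-3 : ℤ)

theorem twPhi_zero (p : ℕ) [Fact p.Prime] (ψ : DirichletCharacter ℂ p) (hψ : ψ ≠ 1)
    (v : Fin 2 → ZMod p) : twPhi p ψ ![0, 0] v = 0 := by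
  have h0 : (![0, 0] : Fin 2 → ZMod p) = 0 := by ext i; fin_cases i <;> rfl
  simp only [twPhi, h0, smul_zero]
  rw [← Finset.sum_mul, MulChar.sum_eq_zero_of_ne_one hψ, zero_mul]

theorem twPhi_col (p : ℕ) [Fact p.Prime] (ψ : DirichletCharacter ℂ p) (s : ZMod p) (hs : s ≠ 0)
    (c d : ZMod p) : twPhi p ψ ![0, s] ![c, d] = if c = 0 then ψ⁻¹ s * ψ d else 0 := by
  rw [twPhi, Finset.sum_eq_single (d * s⁻¹)]
  · rw [MulChar.inv_apply', map_mul]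
    by_cases hc : c = 0
    · simp [hc, hs, mul_comm]
    · simp [hc]
  · intro t _ ht
    have : ![c, d] ≠ t • ![0, s] := by
      intro h
      have h1 := congr_fun h 1
      simp at h1
      apply ht
      rw [h1]; field_simp
    rw [if_neg this, mul_zero]
  · simp

theorem twPhi_row (p : ℕ) [Fact p.Prime] (ψ : DirichletCharacter ℂ p) (r j : ZMod p) (hr : r ≠ 0)
    (c d : ZMod p) :
    twPhi p ψ ![r, j] ![c, d] = if d = c * r⁻¹ * j then ψ⁻¹ r * ψ c else 0 := by
  rw [twPhi, Finset.sum_eq_single (c * r⁻¹)]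
  · rw [MulChar.inv_apply', map_mul]
    by_cases hc : d = c * r⁻¹ * j
    · simp [hc, hr, mul_comm]
    · simp [hc]
  · intro t _ ht
    have : ![c, d] ≠ t • ![r, j] := by
      intro h
      have h1 := congr_fun h 0
      simp at h1
      apply ht
      rw [h1]; field_simp
    rw [if_neg this, mul_zero]
  · simp

theorem twg_zero (p : ℕ) [Fact p.Prime] (ψ : DirichletCharacter ℂ p) (hψ : ψ ≠ 1) (N : ℕ) :
    twg p (twPhi p ψ ![0, 0]) N = 0 := by
  simp [twg, twPhi_zero p ψ hψ]

theorem twg_col_zero (p : ℕ) [Fact p.Prime] (ψ : DirichletCharacter ℂ p) (s : ZMod p)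
    (hs : s ≠ 0) : twg p (twPhi p ψ ![0, s]) 0 = ψ⁻¹ s * twL p ψ := by
  simp only [twg, twPhi_col p ψ s hs, if_true, twL, mul_assoc, tsum_mul_left]

theorem twg_col_mid (p : ℕ) [Fact p.Prime] (ψ : DirichletCharacter ℂ p) (s : ZMod p)
    (hs : s ≠ 0) (N : ℕ) (h0 : N ≠ 0) (hN : N < p) : twg p (twPhi p ψ ![0, s]) N = 0 := by
  simp only [twg, twPhi_col p ψ s hs, h0, if_false]
  rw [Finset.sum_eq_zero, mul_zero]
  intro x hx
  have hx1 := Nat.mem_divisorsAntidiagonal.mp hx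
  have hne : (x.1 : ZMod p) ≠ 0 := by
    rw [Ne, ZMod.natCast_eq_zero_iff]
    intro hd
    have := Nat.le_of_dvd (Nat.pos_of_ne_zero h0) (hd.trans (Dvd.intro _ hx1.1))
    omega
  simp [hne]

theorem twg_col_p (p : ℕ) [Fact p.Prime] (ψ : DirichletCharacter ℂ p) (s : ZMod p)
    (hs : s ≠ 0) :
    twg p (twPhi p ψ ![0, s]) p = twC p * (ψ⁻¹ s * gaussSum ψ ZMod.stdAddChar) := by
  have hp : p.Prime := Fact.out
  simp only [twg, twPhi_col p ψ s hs, hp.ne_zero, if_false]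
  rw [Nat.sum_divisorsAntidiagonal (f := fun a b => (b : ℂ) ^ 2 * ∑ t : ZMod p,
    (if (a : ZMod p) = 0 then ψ⁻¹ s * ψ t else 0) * ZMod.stdAddChar (t * (b : ZMod p))),
    hp.sum_divisors]
  have h1 : p / p = 1 := Nat.div_self hp.pos
  simp [h1, gaussSum, mul_assoc, ← Finset.mul_sum]

theorem twg_row (p : ℕ) [Fact p.Prime] (ψ : DirichletCharacter ℂ p) (r j : ZMod p) (hr : r ≠ 0)
    (N : ℕ) :
    twg p (twPhi p ψ ![r, j]) N = twC p * (ψ⁻¹ r * ZMod.stdAddChar ((N : ZMod p) * (r⁻¹ * j)) *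
      sigmaTw 2 (fun m => ψ ((m : ℕ) : ZMod p)) N) := by
  by_cases hN : N = 0
  · simp [twg, twPhi_row p ψ r j hr, hN, sigmaTw, MulChar.map_nonunit ψ not_isUnit_zero]
  simp only [twg, twPhi_row p ψ r j hr, hN, if_false]
  congr 1
  rw [sigmaTw, ← Nat.sum_divisorsAntidiagonal' (f := fun a b => ψ (a : ZMod p) * (b : ℂ) ^ 2),
    Finset.mul_sum]
  refine Finset.sum_congr rfl fun x hx => ?_
  have hx1 := (Nat.mem_divisorsAntidiagonal.mp hx).1
  rw [Finset.sum_eq_single ((x.1 : ZMod p) * r⁻¹ * j)]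
  · have : (x.1 : ZMod p) * r⁻¹ * j * (x.2 : ZMod p) = (N : ZMod p) * (r⁻¹ * j) := by
      rw [← hx1]; push_cast; ring
    rw [this]
    simp only [if_true]
    ring
  · intro t _ ht
    simp [ht]
  · simp

theorem twBernoulli (p : ℕ) [Fact p.Prime] (ψ : DirichletCharacter ℂ p) (hψ : ψ ≠ 1) :
    gaussSum ψ ZMod.stdAddChar * twL p ψ⁻¹ =
      p * twC p * bernoulliChar p (fun m => ψ ((m : ℕ) : ZMod p)) 3 / 6 := by
  have hp : p.Prime := Fact.out
  have hp0 : (p : ℂ) ≠ 0 := by exact_mod_cast hp.ne_zero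
  have hpr : (0 : ℝ) < p := by exact_mod_cast hp.pos
  have hshift : ∀ n : ZMod p, ∑ a : ZMod p, ψ a * ZMod.stdAddChar (n * a) =
      ψ⁻¹ n * gaussSum ψ ZMod.stdAddChar := by
    intro n
    by_cases hn : n = 0
    · subst hn
      simp [MulChar.sum_eq_zero_of_ne_one hψ, MulChar.map_nonunit ψ⁻¹ not_isUnit_zero]
    · have := gaussSum_mulShift_eq ψ (ZMod.stdAddChar (N := p)) (Units.mk0 n hn)
      simpa [gaussSum, AddChar.mulShift_apply] using this
  have hrange : ∀ f : ZMod p → ℂ, ∑ a ∈ Finset.range p, f (a : ZMod p) = ∑ a : ZMod p, f a := by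
    intro f
    refine Finset.sum_bij' (fun a _ => (a : ZMod p)) (fun a _ => a.val) ?_ ?_ ?_ ?_ ?_
    · simp
    · intro a _; simpa using a.val_lt
    · intro a ha; simpa using ZMod.val_cast_of_lt (Finset.mem_range.mp ha)
    · intro a _; simp
    · simp
  have hB : ∀ a ∈ Finset.range p, HasSum (fun n : ℤ => ψ (a : ZMod p) * (1 / (n : ℂ) ^ 3 *
      ZMod.stdAddChar ((n : ZMod p) * (a : ZMod p)))) (ψ (a : ZMod p) * (-(2 * π * I) ^ 3 / 6 *
        Polynomial.aeval ((a : ℂ) / p) (Polynomial.bernoulli 3))) := by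
    intro a ha
    have hx : (a : ℝ) / p ∈ Set.Icc (0 : ℝ) 1 := by
      have : (a : ℝ) ≤ p := by exact_mod_cast (Finset.mem_range.mp ha).le
      exact ⟨by positivity, (div_le_one hpr).mpr this⟩
    have h := (hasSum_one_div_pow_mul_fourier_mul_bernoulliFun (k := 3) (by norm_num)
      hx).mul_left (ψ (a : ZMod p))
    have e1 : ((bernoulliFun 3 ((a : ℝ) / p) : ℝ) : ℂ) =
        Polynomial.aeval ((a : ℂ) / p) (Polynomial.bernoulli 3) := by
      rw [bernoulliFun, Polynomial.eval_map_algebraMap]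
      have := Polynomial.aeval_algebraMap_apply ℂ ((a : ℝ) / p) (Polynomial.bernoulli 3)
      simp only [Complex.coe_algebraMap] at this
      rw [← this]
      push_cast
      rfl
    rw [e1] at h
    have e2 : ((Nat.factorial 3 : ℕ) : ℂ) = 6 := by norm_num [Nat.factorial]
    rw [e2] at h
    refine h.congr_fun fun n => ?_
    congr 2
    have h1 := ZMod.stdAddChar_coe (N := p) (n * a)
    rw [fourier_coe_apply]
    push_cast at h1
    rw [h1]
    congr 1
    push_cast
    ring
  have hsum := hasSum_sum hB
  have hfin : HasSum (fun n : ℤ => gaussSum ψ ZMod.stdAddChar *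
      (ψ⁻¹ (n : ZMod p) * (n : ℂ) ^ (-3 : ℤ)))
      (∑ a ∈ Finset.range p, ψ (a : ZMod p) * (-(2 * π * I) ^ 3 / 6 *
        Polynomial.aeval ((a : ℂ) / p) (Polynomial.bernoulli 3))) := by
    refine hsum.congr_fun fun n => ?_
    rw [hrange (fun a => ψ a * (1 / (n : ℂ) ^ 3 * ZMod.stdAddChar ((n : ZMod p) * a)))]
    have := hshift (n : ZMod p)
    calc gaussSum ψ ZMod.stdAddChar * (ψ⁻¹ (n : ZMod p) * (n : ℂ) ^ (-3 : ℤ))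
        = (n : ℂ) ^ (-3 : ℤ) * (ψ⁻¹ (n : ZMod p) * gaussSum ψ ZMod.stdAddChar) := by ring
      _ = _ := by
        rw [← this, Finset.mul_sum]
        refine Finset.sum_congr rfl fun a _ => ?_
        rw [zpow_neg, one_div, zpow_ofNat]
        ring
  have := hfin.tsum_eq
  rw [tsum_mul_left] at this
  rw [twL, this, bernoulliChar, twC, Finset.mul_sum, Finset.mul_sum, Finset.sum_div]
  refine Finset.sum_congr rfl fun a _ => ?_
  field_simp
  ring

theorem twGauss (p : ℕ) [Fact p.Prime] (χ : DirichletCharacter ℂ p) (hχ1 : χ ≠ 1)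
    (hχ' : χ⁻¹ (-1) = -1) :
    gaussSum χ ZMod.stdAddChar * gaussSum χ⁻¹ ZMod.stdAddChar = -(p : ℂ) := by
  have h1 := gaussSum_mul_gaussSum_eq_card hχ1 (ZMod.isPrimitive_stdAddChar p)
  have h2 := mul_gaussSum_inv_eq_gaussSum χ⁻¹ (ZMod.stdAddChar (N := p))
  rw [hχ'] at h2
  rw [← h2]
  rw [ZMod.card] at h1
  linear_combination -h1

theorem tw_sum_ite (p : ℕ) [Fact p.Prime] (x y : ℂ) :
    ∑ r : ZMod p, (if r = 0 then x else y) = x + (p - 1) * y := by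
  have : ∀ r : ZMod p, (if r = 0 then x else y) = (if r = 0 then x - y else 0) + y := by
    intro r; split_ifs <;> ring
  simp only [this, Finset.sum_add_distrib]
  simp
  ring

theorem tw_sum_fin (p : ℕ) [Fact p.Prime] (P : (Fin 2 → ZMod p) → ℂ) (A B : ℂ)
    (h0 : P ![0, 0] = 0) (hA : ∀ s, s ≠ 0 → P ![0, s] = A)
    (hB : ∀ r j, r ≠ 0 → P ![r, j] = B) :
    ∑ a, P a = (p - 1) * (A + p * B) := by
  rw [← (finTwoArrowEquiv (ZMod p)).symm.sum_comp, Fintype.sum_prod_type]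
  simp only [finTwoArrowEquiv_symm_apply]
  have h1 : ∀ r : ZMod p, ∑ j : ZMod p, P ![r, j] =
      if r = 0 then (p - 1) * A else p * B := by
    intro r
    split_ifs with hr
    · subst hr
      have : ∀ j : ZMod p, P ![0, j] = if j = 0 then 0 else A := by
        intro j
        split_ifs with hj
        · rw [hj, h0]
        · exact hA j hj
      simp only [this, tw_sum_ite, zero_add]
    · simp [hB r _ hr]
  simp only [h1, tw_sum_ite]
  ring

theorem tw_inv_mul (p : ℕ) [Fact p.Prime] (χ : DirichletCharacter ℂ p) (s : ZMod p)
    (hs : s ≠ 0) : χ⁻¹ s * χ s = 1 := by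
  rw [← MulChar.mul_apply, inv_mul_cancel]
  exact MulChar.one_apply (isUnit_iff_ne_zero.mpr hs)

theorem tw_f_zero (p : ℕ) [Fact p.Prime] (χ : DirichletCharacter ℂ p) (hχ1 : χ ≠ 1) :
    twf p χ 0 = (p - 1) * (twL p χ * twL p χ⁻¹) := by
  rw [twf, tw_sum_fin p _ (twL p χ * twL p χ⁻¹) 0]
  · ring
  · simp [twg_zero p χ hχ1]
  · intro s hs
    simp only [Finset.HasAntidiagonal.antidiagonal_zero, Finset.sum_singleton, twg_col_zero p _ s hs, inv_inv]
    linear_combination (twL p χ * twL p χ⁻¹) * tw_inv_mul p χ s hs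
  · intro r j hr
    simp [twg_row p _ r j hr, sigmaTw]

theorem tw_f_p (p : ℕ) [Fact p.Prime] (χ : DirichletCharacter ℂ p) (hχ1 : χ ≠ 1) :
    twf p χ p = (p - 1) * (twC p * (gaussSum χ ZMod.stdAddChar * twL p χ⁻¹ +
      gaussSum χ⁻¹ ZMod.stdAddChar * twL p χ) + p * (twC p ^ 2 *
        ∑ x ∈ Finset.HasAntidiagonal.antidiagonal p, sigmaTw 2 (fun m => χ ((m : ℕ) : ZMod p)) x.1 *
          sigmaTw 2 (fun m => χ⁻¹ ((m : ℕ) : ZMod p)) x.2)) := by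
  have hp : p.Prime := Fact.out
  rw [twf, tw_sum_fin p _ _ _ _ _ _]
  · simp [twg_zero p χ hχ1]
  · intro s hs
    have hsub : ({(0, p), (p, 0)} : Finset (ℕ × ℕ)) ⊆ Finset.HasAntidiagonal.antidiagonal p := by
      intro x hx
      simp only [Finset.mem_insert, Finset.mem_singleton] at hx
      rcases hx with rfl | rfl <;> simp
    rw [← Finset.sum_subset hsub, Finset.sum_pair (by simp [hp.ne_zero.symm])]
    · simp only [twg_col_zero p _ s hs, twg_col_p p _ s hs, inv_inv]
      linear_combination (twC p * (gaussSum χ ZMod.stdAddChar * twL p χ⁻¹ +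
        gaussSum χ⁻¹ ZMod.stdAddChar * twL p χ)) * tw_inv_mul p χ s hs
    · rintro ⟨x, y⟩ hx hnx
      simp only [Finset.HasAntidiagonal.mem_antidiagonal] at hx
      simp only [Finset.mem_insert, Finset.mem_singleton, Prod.mk.injEq, not_or] at hnx
      rw [twg_col_mid p χ s hs x (by omega) (by omega), zero_mul]
  · intro r j hr
    rw [Finset.mul_sum]
    refine Finset.sum_congr rfl fun x hx => ?_
    have hx1 := Finset.HasAntidiagonal.mem_antidiagonal.mp hx
    simp only [twg_row p _ r j hr, inv_inv]
    have he : ZMod.stdAddChar ((x.1 : ZMod p) * (r⁻¹ * j)) *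
        ZMod.stdAddChar ((x.2 : ZMod p) * (r⁻¹ * j)) = 1 := by
      rw [← AddChar.map_add_eq_mul, ← add_mul, ← Nat.cast_add, hx1]
      simp
    have hi := tw_inv_mul p χ r hr
    generalize ZMod.stdAddChar ((x.1 : ZMod p) * (r⁻¹ * j)) = e1 at *
    generalize ZMod.stdAddChar ((x.2 : ZMod p) * (r⁻¹ * j)) = e2 at *
    generalize χ⁻¹ r = u at *
    generalize χ r = v at *
    calc _ = (u * v) * (e1 * e2) * (twC p ^ 2 * (sigmaTw 2 (fun m => χ ((m : ℕ) : ZMod p)) x.1 *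
          sigmaTw 2 (fun m => χ⁻¹ ((m : ℕ) : ZMod p)) x.2)) := by ring
      _ = _ := by rw [hi, he]; ring

theorem tw_main (p : ℕ) [Fact p.Prime] (χ : DirichletCharacter ℂ p)
    (hχ : χ (-1) = -1) :
    ∑ x ∈ Finset.HasAntidiagonal.antidiagonal p, sigmaTw 2 (fun m => χ ((m : ℕ) : ZMod p)) x.1 *
          sigmaTw 2 (fun m => χ⁻¹ ((m : ℕ) : ZMod p)) x.2 =
      -(bernoulliChar p (fun m => χ⁻¹ ((m : ℕ) : ZMod p)) 3) / 6
        - bernoulliChar p (fun m => χ ((m : ℕ) : ZMod p)) 3 / 6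
        + 14 * (bernoulliChar p (fun m => χ⁻¹ ((m : ℕ) : ZMod p)) 3
            * bernoulliChar p (fun m => χ ((m : ℕ) : ZMod p)) 3) := by
  have hp : p.Prime := Fact.out
  have hp0 : (p : ℂ) ≠ 0 := by exact_mod_cast hp.ne_zero
  have hp1 : (p : ℂ) - 1 ≠ 0 := by
    rw [sub_ne_zero]; exact_mod_cast hp.one_lt.ne'
  have hχ1 : χ ≠ 1 := by
    rintro rfl
    rw [MulChar.one_apply (isUnit_one.neg)] at hχ
    norm_num at hχ
  have hχi1 : χ⁻¹ ≠ 1 := by simpa using hχ1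
  have hχ' : χ⁻¹ (-1) = -1 := by
    rw [MulChar.inv_apply', inv_neg, inv_one, hχ]
  have hC : twC p ≠ 0 := by
    rw [twC]
    refine div_ne_zero (pow_ne_zero _ ?_) (pow_ne_zero _ hp0)
    simp [Real.pi_ne_zero]
  have hkey := twf_key p χ hχ hχ'
  rw [tw_f_zero p χ hχ1, tw_f_p p χ hχ1] at hkey
  have hb1 := twBernoulli p χ hχ1
  have hb2 := twBernoulli p χ⁻¹ hχi1
  rw [inv_inv] at hb2
  have hg := twGauss p χ hχ1 hχ'
  generalize gaussSum χ ZMod.stdAddChar = g at *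
  generalize gaussSum χ⁻¹ ZMod.stdAddChar = g' at *
  generalize twL p χ = L at *
  generalize twL p χ⁻¹ = L' at *
  generalize bernoulliChar p (fun m => χ ((m : ℕ) : ZMod p)) 3 = B at *
  generalize bernoulliChar p (fun m => χ⁻¹ ((m : ℕ) : ZMod p)) 3 = B' at *
  generalize (∑ x ∈ Finset.HasAntidiagonal.antidiagonal p,
    sigmaTw 2 (fun m => χ ((m : ℕ) : ZMod p)) x.1 *
          sigmaTw 2 (fun m => χ⁻¹ ((m : ℕ) : ZMod p)) x.2) = S at *
  generalize twC p = C at *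
  generalize (p : ℂ) = q at *
  have hLL : -q * (L * L') = (q * C * B / 6) * (q * C * B' / 6) := by
    rw [← hb1, ← hb2, ← hg]; ring
  have hLL' : L * L' = -(q * C ^ 2 * B * B' / 36) := by
    apply mul_left_cancel₀ hp0
    linear_combination -hLL
  have hk2 : C * (g * L' + g' * L) + q * (C ^ 2 * S) = -504 * (L * L') := by
    apply mul_left_cancel₀ hp1
    linear_combination hkey
  rw [hb1, hb2, hLL'] at hk2
  have hne : q * C ^ 2 ≠ 0 := mul_ne_zero hp0 (pow_ne_zero _ hC)
  apply mul_left_cancel₀ hne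
  linear_combination hk2

end TwHelpers

/-- For a prime `p > 2` and a primitive odd character `χ` mod `p`,
`∑_{n=1}^{p} σ_{2,𝟙,χ̄}(n) σ_{2,𝟙,χ}(p−n) = −B_{3,χ̄}/6 − B_{3,χ}/6 + B_{3,χ̄}B_{3,χ}/(3B₆)`. -/
theorem convolution_twisted_divisor_weight6 (p : ℕ) (hp : p.Prime) (hp2 : 2 < p)
    (χ : DirichletCharacter ℂ p) (hprim : χ.IsPrimitive)
    (hoddχ : χ (-1) = -1) :
    ∑ n ∈ Finset.Icc 1 p,
        sigmaTw 2 (fun m => (starRingEnd ℂ) (χ ((m : ℕ) : ZMod p))) n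
          * sigmaTw 2 (fun m => χ ((m : ℕ) : ZMod p)) (p - n)
      = -(bernoulliChar p (fun m => (starRingEnd ℂ) (χ ((m : ℕ) : ZMod p))) 3) / 6
        - bernoulliChar p (fun m => χ ((m : ℕ) : ZMod p)) 3 / 6
        + bernoulliChar p (fun m => (starRingEnd ℂ) (χ ((m : ℕ) : ZMod p))) 3
            * bernoulliChar p (fun m => χ ((m : ℕ) : ZMod p)) 3
            / (3 * ((bernoulli 6 : ℚ) : ℂ)) := by
  haveI : Fact p.Prime := ⟨hp⟩
  have hc : (fun m : ℕ => (starRingEnd ℂ) (χ ((m : ℕ) : ZMod p))) =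
      fun m : ℕ => χ⁻¹ ((m : ℕ) : ZMod p) := by
    funext m
    exact MulChar.star_apply' χ (m : ZMod p)
  have h6 : bernoulli 6 = 1 / 42 := by decide +kernel
  have hm := tw_main p χ hoddχ
  have hsum : ∑ n ∈ Finset.Icc 1 p, sigmaTw 2 (fun m => χ⁻¹ ((m : ℕ) : ZMod p)) n
          * sigmaTw 2 (fun m => χ ((m : ℕ) : ZMod p)) (p - n) =
      ∑ x ∈ Finset.HasAntidiagonal.antidiagonal p, sigmaTw 2 (fun m => χ ((m : ℕ) : ZMod p)) x.1 *
          sigmaTw 2 (fun m => χ⁻¹ ((m : ℕ) : ZMod p)) x.2 := by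
    rw [← Finset.Nat.sum_antidiagonal_swap, Finset.Nat.sum_antidiagonal_eq_sum_range_succ_mk]
    have hsub : Finset.Icc 1 p ⊆ Finset.range p.succ := by
      intro n hn
      have := Finset.mem_Icc.mp hn
      exact Finset.mem_range.mpr (by omega)
    rw [← Finset.sum_subset hsub]
    · exact Finset.sum_congr rfl fun n _ => mul_comm _ _
    · intro n hn hn2
      have hn0 : n = 0 := by
        simp only [Finset.mem_range, Finset.mem_Icc] at hn hn2
        omega
      simp [hn0, sigmaTw]
  rw [hc, hsum, hm, h6]
  push_cast
  ring
end

section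
/- Let p > 2 be prime and χ a primitive Dirichlet character mod p with χ(−1) = −1. Then ∑_{n=1}^{p−1} σ_{2,𝟙,χ̄}(n) σ_{4,𝟙,χ}(p−n) (3p − 8n) = (p/2)(B_{5,χ̄} − B_{3,χ}), where σ_{k−1,𝟙,χ}(n) = ∑_{d₁d₂=n, d₁,d₂>0} χ(d₂) d₁^{k−1}, and B_{n,χ} are the generalized Bernoulli numbers. -/
namespace ConvTw

/-- Positive quadruples `(a, b, c, d)` with `ab + cd = p`. -/
def quads (p : ℕ) : Finset (ℕ × ℕ × ℕ × ℕ) :=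
  (Finset.Ico 1 p ×ˢ Finset.Ico 1 p ×ˢ Finset.Ico 1 p ×ˢ Finset.Ico 1 p).filter
    (fun q => q.1 * q.2.1 + q.2.2.1 * q.2.2.2 = p)

lemma mem_quads {p a b c d : ℕ} :
    (a, b, c, d) ∈ quads p ↔ 0 < a ∧ 0 < b ∧ 0 < c ∧ 0 < d ∧ a * b + c * d = p := by
  simp only [quads, Finset.mem_filter, Finset.mem_product, Finset.mem_Ico]
  constructor
  · rintro ⟨⟨⟨h1, -⟩, ⟨h2, -⟩, ⟨h3, -⟩, ⟨h4, -⟩⟩, h⟩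
    exact ⟨h1, h2, h3, h4, h⟩
  · rintro ⟨h1, h2, h3, h4, h⟩
    have hab : 0 < a * b := Nat.mul_pos h1 h2
    have hcd : 0 < c * d := Nat.mul_pos h3 h4
    have e1 : a ≤ a * b := Nat.le_mul_of_pos_right a h2
    have e2 : b ≤ a * b := Nat.le_mul_of_pos_left b h1
    have e3 : c ≤ c * d := Nat.le_mul_of_pos_right c h4
    have e4 : d ≤ c * d := Nat.le_mul_of_pos_left d h3
    exact ⟨⟨⟨h1, by omega⟩, ⟨h2, by omega⟩, ⟨h3, by omega⟩, ⟨h4, by omega⟩⟩, h⟩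

/-- The sum over the quadruples. -/
lemma sum_quads_eq (p : ℕ) (f g : ℕ → ℂ) :
    ∑ n ∈ Finset.Ico 1 p, sigmaTw 2 f n * sigmaTw 4 g (p - n) * (3 * (p : ℂ) - 8 * (n : ℂ))
      = ∑ q ∈ quads p, f q.2.1 * g q.2.2.2 * ((q.1 : ℂ) ^ 2 * (q.2.2.1 : ℂ) ^ 4 *
          (3 * (q.2.2.1 : ℂ) * q.2.2.2 - 5 * (q.1 : ℂ) * q.2.1)) := by
  have h1 : ∀ n ∈ Finset.Ico 1 p,
      sigmaTw 2 f n * sigmaTw 4 g (p - n) * (3 * (p : ℂ) - 8 * (n : ℂ))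
      = ∑ x ∈ n.divisors ×ˢ (p - n).divisors,
        (f (n / x.1) * (x.1 : ℂ) ^ 2) * (g ((p - n) / x.2) * (x.2 : ℂ) ^ 4)
          * (3 * (p : ℂ) - 8 * (n : ℂ)) := by
    intro n _
    rw [sigmaTw, sigmaTw, Finset.sum_mul_sum, ← Finset.sum_product', Finset.sum_mul]
  rw [Finset.sum_congr rfl h1, Finset.sum_sigma']
  refine Finset.sum_bij'
    (fun y _ => (y.2.1, y.1 / y.2.1, y.2.2, (p - y.1) / y.2.2))
    (fun q _ => ⟨q.1 * q.2.1, (q.1, q.2.2.1)⟩) ?_ ?_ ?_ ?_ ?_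
  · rintro ⟨n, x, y⟩ h
    simp only [Finset.mem_sigma, Finset.mem_Ico, Finset.mem_product, Nat.mem_divisors] at h
    obtain ⟨⟨hn1, hn2⟩, ⟨⟨b, rfl⟩, hn⟩, ⟨⟨d, hd⟩, hpn⟩⟩ := h
    have hx : 0 < x := Nat.pos_of_ne_zero (by rintro rfl; simp at hn)
    have hb : 0 < b := Nat.pos_of_ne_zero (by rintro rfl; simp at hn)
    have hy : 0 < y := Nat.pos_of_ne_zero (by rintro rfl; simp at hd; omega)
    have hd0 : 0 < d := Nat.pos_of_ne_zero (by rintro rfl; simp at hd; omega)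
    dsimp only
    rw [hd, Nat.mul_div_cancel_left _ hx, Nat.mul_div_cancel_left _ hy, mem_quads]
    exact ⟨hx, hb, hy, hd0, by omega⟩
  · rintro ⟨a, b, c, d⟩ h
    obtain ⟨ha, hb, hc, hd, h⟩ := mem_quads.1 h
    have hab : 0 < a * b := Nat.mul_pos ha hb
    have hcd : 0 < c * d := Nat.mul_pos hc hd
    simp only [Finset.mem_sigma, Finset.mem_Ico, Finset.mem_product, Nat.mem_divisors]
    refine ⟨⟨hab, by omega⟩, ⟨Dvd.intro _ rfl, by omega⟩, ⟨⟨d, by omega⟩, by omega⟩⟩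
  · rintro ⟨n, x, y⟩ h
    simp only [Finset.mem_sigma, Finset.mem_Ico, Finset.mem_product, Nat.mem_divisors] at h
    obtain ⟨⟨hn1, hn2⟩, ⟨hx, hn⟩, _⟩ := h
    dsimp only
    rw [Nat.mul_div_cancel' hx]
  · rintro ⟨a, b, c, d⟩ h
    obtain ⟨ha, hb, hc, hd, h⟩ := mem_quads.1 h
    have e : p - a * b = c * d := by omega
    dsimp only
    rw [e, Nat.mul_div_cancel_left _ ha, Nat.mul_div_cancel_left _ hc]
  · rintro ⟨n, x, y⟩ h
    simp only [Finset.mem_sigma, Finset.mem_Ico, Finset.mem_product, Nat.mem_divisors] at h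
    obtain ⟨⟨hn1, hn2⟩, ⟨⟨b, rfl⟩, hn⟩, ⟨⟨d, hd⟩, hpn⟩⟩ := h
    have hx : 0 < x := Nat.pos_of_ne_zero (by rintro rfl; simp at hn)
    have hy : 0 < y := Nat.pos_of_ne_zero (by rintro rfl; simp at hd; omega)
    dsimp only
    rw [hd, Nat.mul_div_cancel_left _ hx, Nat.mul_div_cancel_left _ hy]
    have hp : p = x * b + y * d := by omega
    rw [hp]
    push_cast
    ring

/-- The Euclidean-algorithm bijection. -/
lemma sum_shift (p : ℕ) (F : ℕ × ℕ × ℕ × ℕ → ℂ) :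
    ∑ q ∈ (quads p).filter (fun q => q.2.1 < q.2.2.1), F q
      = ∑ q ∈ (quads p).filter (fun q => q.2.2.2 < q.1),
          F (q.1 - q.2.2.2, q.2.1, q.2.2.1 + q.2.1, q.2.2.2) := by
  refine Finset.sum_bij'
    (fun q _ => (q.1 + q.2.2.2, q.2.1, q.2.2.1 - q.2.1, q.2.2.2))
    (fun q _ => (q.1 - q.2.2.2, q.2.1, q.2.2.1 + q.2.1, q.2.2.2)) ?_ ?_ ?_ ?_ ?_
  · rintro ⟨a, b, c, d⟩ h
    rw [Finset.mem_filter, mem_quads] at h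
    obtain ⟨⟨ha, hb, hc, hd, h⟩, hlt⟩ := h
    dsimp only at hlt ⊢
    rw [Finset.mem_filter, mem_quads]
    obtain ⟨k, rfl⟩ := Nat.exists_eq_add_of_lt hlt
    refine ⟨⟨by omega, hb, by omega, hd, ?_⟩, ?_⟩
    · rw [← h, show b + k + 1 - b = k + 1 by omega]; ring
    · dsimp only; omega
  · rintro ⟨a, b, c, d⟩ h
    rw [Finset.mem_filter, mem_quads] at h
    obtain ⟨⟨ha, hb, hc, hd, h⟩, hlt⟩ := h
    dsimp only at hlt ⊢
    rw [Finset.mem_filter, mem_quads]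
    obtain ⟨k, rfl⟩ := Nat.exists_eq_add_of_lt hlt
    refine ⟨⟨by omega, hb, by omega, hd, ?_⟩, ?_⟩
    · rw [← h, show d + k + 1 - d = k + 1 by omega]; ring
    · dsimp only; omega
  · rintro ⟨a, b, c, d⟩ h
    rw [Finset.mem_filter, mem_quads] at h
    have := h.2
    dsimp only at this ⊢
    rw [Nat.add_sub_cancel, Nat.sub_add_cancel this.le]
  · rintro ⟨a, b, c, d⟩ h
    rw [Finset.mem_filter, mem_quads] at h
    have := h.2
    dsimp only at this ⊢
    rw [Nat.add_sub_cancel, Nat.sub_add_cancel this.le]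
  · rintro ⟨a, b, c, d⟩ h
    rw [Finset.mem_filter, mem_quads] at h
    have := h.2
    dsimp only at this ⊢
    rw [Nat.add_sub_cancel, Nat.sub_add_cancel this.le]

/-- The swap symmetry. -/
lemma sum_swap (p : ℕ) (P Q : ℕ × ℕ × ℕ × ℕ → Prop) [DecidablePred P] [DecidablePred Q]
    (hPQ : ∀ a b c d, P (a, b, c, d) ↔ Q (d, c, b, a)) (F : ℕ × ℕ × ℕ × ℕ → ℂ) :
    ∑ q ∈ (quads p).filter P, F q
      = ∑ q ∈ (quads p).filter Q, F (q.2.2.2, q.2.2.1, q.2.1, q.1) := by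
  have key : ∀ a b c d, (a, b, c, d) ∈ quads p → (d, c, b, a) ∈ quads p := by
    intro a b c d h
    rw [mem_quads] at h ⊢
    obtain ⟨ha, hb, hc, hd, h⟩ := h
    exact ⟨hd, hc, hb, ha, by rw [← h]; ring⟩
  refine Finset.sum_bij'
    (fun q _ => (q.2.2.2, q.2.2.1, q.2.1, q.1))
    (fun q _ => (q.2.2.2, q.2.2.1, q.2.1, q.1)) ?_ ?_ ?_ ?_ ?_
  · rintro ⟨a, b, c, d⟩ h
    rw [Finset.mem_filter] at h ⊢
    exact ⟨key _ _ _ _ h.1, (hPQ _ _ _ _).1 h.2⟩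
  · rintro ⟨a, b, c, d⟩ h
    rw [Finset.mem_filter] at h ⊢
    exact ⟨key _ _ _ _ h.1, (hPQ _ _ _ _).2 h.2⟩
  · rintro ⟨a, b, c, d⟩ h; rfl
  · rintro ⟨a, b, c, d⟩ h; rfl
  · rintro ⟨a, b, c, d⟩ h; rfl

/-- Splitting along a trichotomy. -/
lemma sum_split (p : ℕ) (u v : ℕ × ℕ × ℕ × ℕ → ℕ) (F : ℕ × ℕ × ℕ × ℕ → ℂ) :
    ∑ q ∈ quads p, F q = ∑ q ∈ (quads p).filter (fun q => u q < v q), F q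
      + ∑ q ∈ (quads p).filter (fun q => v q < u q), F q
      + ∑ q ∈ (quads p).filter (fun q => u q = v q), F q := by
  simp only [Finset.sum_filter, ← Finset.sum_add_distrib]
  refine Finset.sum_congr rfl fun q _ => ?_
  rcases lt_trichotomy (u q) (v q) with h | h | h
  · simp [h, h.ne, h.not_gt]
  · simp [h]
  · simp [h, h.ne', h.not_gt]

/-- A factorization of a prime through equal entries. -/
lemma eq_one_of_mul {p x y : ℕ} (hp : p.Prime) (hy : 2 ≤ y) (h : x * y = p) : x = 1 := by
  rcases (Nat.dvd_prime hp).1 (Dvd.intro _ h) with h1 | h1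
  · exact h1
  · subst h1
    have : x * 2 ≤ x * y := Nat.mul_le_mul_left x hy
    have := hp.pos
    omega

lemma sum_diag_bc (p : ℕ) (hp : p.Prime) (F : ℕ × ℕ × ℕ × ℕ → ℂ) :
    ∑ q ∈ (quads p).filter (fun q => q.2.1 = q.2.2.1), F q
      = ∑ d ∈ Finset.Ico 1 p, F (p - d, 1, 1, d) := by
  symm
  refine Finset.sum_bij' (fun d _ => (p - d, 1, 1, d)) (fun q _ => q.2.2.2) ?_ ?_ ?_ ?_ ?_
  · intro d h
    rw [Finset.mem_Ico] at h
    rw [Finset.mem_filter, mem_quads]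
    refine ⟨⟨by omega, one_pos, one_pos, by omega, by omega⟩, rfl⟩
  · rintro ⟨a, b, c, d⟩ h
    rw [Finset.mem_filter] at h
    have h := h.1
    simp only [quads, Finset.mem_filter, Finset.mem_product] at h
    exact h.1.2.2.2
  · intro d h; rfl
  · rintro ⟨a, b, c, d⟩ h
    rw [Finset.mem_filter, mem_quads] at h
    obtain ⟨⟨ha, hb, hc, hd, h⟩, hlt⟩ := h
    dsimp only at hlt ⊢
    subst hlt
    have h1 : b = 1 := eq_one_of_mul hp (show 2 ≤ a + d by omega) (by rw [← h]; ring)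
    subst h1
    rw [show p - d = a by omega]
  · intro d h; rfl

lemma sum_diag_ad (p : ℕ) (hp : p.Prime) (F : ℕ × ℕ × ℕ × ℕ → ℂ) :
    ∑ q ∈ (quads p).filter (fun q => q.2.2.2 = q.1), F q
      = ∑ b ∈ Finset.Ico 1 p, F (1, b, p - b, 1) := by
  symm
  refine Finset.sum_bij' (fun b _ => (1, b, p - b, 1)) (fun q _ => q.2.1) ?_ ?_ ?_ ?_ ?_
  · intro d h
    rw [Finset.mem_Ico] at h
    rw [Finset.mem_filter, mem_quads]
    refine ⟨⟨one_pos, by omega, by omega, one_pos, by omega⟩, rfl⟩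
  · rintro ⟨a, b, c, d⟩ h
    rw [Finset.mem_filter] at h
    have h := h.1
    simp only [quads, Finset.mem_filter, Finset.mem_product] at h
    exact h.1.2.1
  · intro d h; rfl
  · rintro ⟨a, b, c, d⟩ h
    rw [Finset.mem_filter, mem_quads] at h
    obtain ⟨⟨ha, hb, hc, hd, h⟩, hlt⟩ := h
    dsimp only at hlt ⊢
    subst hlt
    have h1 : d = 1 := eq_one_of_mul hp (show 2 ≤ b + c by omega) (by rw [← h]; ring)
    subst h1
    rw [show p - b = c by omega]
  · intro d h; rfl

/-- The auxiliary polynomial, a polarization of a `D₃`-invariant form of degree 8. -/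
def polyF (a b c d : ℂ) : ℂ :=
  a^3 * b^4 * c - 10 * a^3 * b^2 * c^3 + 15 * a^3 * b * c^4 - 6 * a^3 * c^5 + 3 * a^2 * b^5 * d
  - 6 * a^2 * b^3 * c^2 * d + 15 * a^2 * b * c^4 * d - 9 * a^2 * c^5 * d + 9 * a * b^5 * d^2
  - 15 * a * b^4 * c * d^2 + 6 * a * b^2 * c^3 * d^2 - 3 * a * c^5 * d^2 + 6 * b^5 * d^3
  - 15 * b^4 * c * d^3 + 10 * b^3 * c^2 * d^3 - b * c^4 * d^3

lemma polyF_swap (a b c d : ℂ) : polyF d c b a = - polyF a b c d := by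
  unfold polyF; ring

lemma polyF_shift_swap (a b c d : ℂ) :
    polyF (d - a) c (b + c) a = - polyF (a - d) b (c + b) d := by
  unfold polyF; ring

lemma polyF_sub (a b c d : ℂ) : polyF a b c d - polyF (a - d) b (c + b) d
    = -6 * (a ^ 2 * c ^ 4 * (3 * c * d - 5 * a * b))
      + 6 * (d ^ 2 * b ^ 4 * (3 * b * a - 5 * d * c)) := by
  unfold polyF; ring

lemma bern3 (x : ℂ) : Polynomial.aeval x (Polynomial.bernoulli 3)
    = x ^ 3 - 3 / 2 * x ^ 2 + x / 2 := by
  have h3 : bernoulli 3 = 0 := bernoulli_eq_zero_of_odd (by decide) (by norm_num)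
  simp only [Polynomial.bernoulli, Finset.sum_range_succ, Finset.sum_range_zero, map_add,
    Polynomial.aeval_monomial, bernoulli_zero, bernoulli_one, bernoulli_two, h3]
  simp [Nat.choose]
  ring

lemma bern5 (x : ℂ) : Polynomial.aeval x (Polynomial.bernoulli 5)
    = x ^ 5 - 5 / 2 * x ^ 4 + 5 / 3 * x ^ 3 - x / 6 := by
  have h3 : bernoulli 3 = 0 := bernoulli_eq_zero_of_odd (by decide) (by norm_num)
  have h5 : bernoulli 5 = 0 := bernoulli_eq_zero_of_odd (by decide) (by norm_num)
  have h4 : bernoulli 4 = -1 / 30 := by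
    rw [bernoulli_eq_bernoulli'_of_ne_one (by norm_num), bernoulli'_four]
  simp only [Polynomial.bernoulli, Finset.sum_range_succ, Finset.sum_range_zero, map_add,
    Polynomial.aeval_monomial, bernoulli_zero, bernoulli_one, bernoulli_two, h3, h4, h5]
  simp [Nat.choose]
  ring

lemma bernoulliChar3 (p : ℕ) (hp : 0 < p) (f : ℕ → ℂ) (hf : f 0 = 0) :
    ∑ d ∈ Finset.Ico 1 p, f d * polyF ((p - d : ℕ) : ℂ) 1 1 d
      = 6 * p * bernoulliChar p f 3 := by
  have hp0 : (p : ℂ) ≠ 0 := by exact_mod_cast hp.ne'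
  rw [bernoulliChar, Finset.range_eq_Ico, Finset.sum_eq_sum_Ico_succ_bot hp, hf, zero_mul,
    zero_add, ← mul_assoc, Finset.mul_sum]
  refine Finset.sum_congr rfl fun d hd => ?_
  rw [Finset.mem_Ico] at hd
  rw [bern3, Nat.cast_sub hd.2.le, polyF]
  field_simp
  ring

lemma bernoulliChar5 (p : ℕ) (hp : 0 < p) (f : ℕ → ℂ) (hf : f 0 = 0) :
    ∑ b ∈ Finset.Ico 1 p, f b * polyF (1 - 1) b (((p - b : ℕ) : ℂ) + b) 1
      = 6 * p * bernoulliChar p f 5 := by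
  have hp0 : (p : ℂ) ≠ 0 := by exact_mod_cast hp.ne'
  rw [bernoulliChar, Finset.range_eq_Ico, Finset.sum_eq_sum_Ico_succ_bot hp, hf, zero_mul,
    zero_add, ← mul_assoc, Finset.mul_sum]
  refine Finset.sum_congr rfl fun d hd => ?_
  rw [Finset.mem_Ico] at hd
  rw [bern5, Nat.cast_sub hd.2.le, polyF]
  field_simp
  ring

/-- The main identity, for a weight `f b * g d` which is odd under the swap. -/
lemma main_identity (p : ℕ) (hp : p.Prime) (f g : ℕ → ℂ) (hf0 : f 0 = 0) (hg0 : g 0 = 0)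
    (hf1 : f 1 = 1) (hg1 : g 1 = 1)
    (hodd : ∀ a b c d, (a, b, c, d) ∈ quads p → f c * g a = - (f b * g d)) :
    ∑ q ∈ quads p, f q.2.1 * g q.2.2.2 * ((q.1 : ℂ) ^ 2 * (q.2.2.1 : ℂ) ^ 4 *
          (3 * (q.2.2.1 : ℂ) * q.2.2.2 - 5 * (q.1 : ℂ) * q.2.1))
      = (p : ℂ) / 2 * (bernoulliChar p f 5 - bernoulliChar p g 3) := by
  set F : ℕ × ℕ × ℕ × ℕ → ℂ := fun q =>
    f q.2.1 * g q.2.2.2 * polyF q.1 q.2.1 q.2.2.1 q.2.2.2 with hF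
  set G : ℕ × ℕ × ℕ × ℕ → ℂ := fun q =>
    f q.2.1 * g q.2.2.2 * polyF ((q.1 : ℂ) - q.2.2.2) q.2.1 ((q.2.2.1 : ℂ) + q.2.1) q.2.2.2
    with hG
  set H : ℕ × ℕ × ℕ × ℕ → ℂ := fun q =>
    f q.2.1 * g q.2.2.2 * ((q.1 : ℂ) ^ 2 * (q.2.2.1 : ℂ) ^ 4 *
          (3 * (q.2.2.1 : ℂ) * q.2.2.2 - 5 * (q.1 : ℂ) * q.2.1)) with hH
  -- splitting of the sum of `F`
  have s1 : ∑ q ∈ (quads p).filter (fun q => q.2.2.1 < q.2.1), F q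
      = ∑ q ∈ (quads p).filter (fun q => q.2.1 < q.2.2.1), F q := by
    rw [sum_swap p (fun q => q.2.2.1 < q.2.1) (fun q => q.2.1 < q.2.2.1)
      (fun a b c d => Iff.rfl)]
    refine Finset.sum_congr rfl ?_
    rintro ⟨a, b, c, d⟩ h
    rw [Finset.mem_filter] at h
    simp only [hF]
    rw [hodd a b c d h.1, polyF_swap]; ring
  have s2 : ∑ q ∈ (quads p).filter (fun q => q.1 < q.2.2.2), G q
      = ∑ q ∈ (quads p).filter (fun q => q.2.2.2 < q.1), G q := by
    rw [sum_swap p (fun q => q.1 < q.2.2.2) (fun q => q.2.2.2 < q.1)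
      (fun a b c d => Iff.rfl)]
    refine Finset.sum_congr rfl ?_
    rintro ⟨a, b, c, d⟩ h
    rw [Finset.mem_filter] at h
    simp only [hG]
    rw [hodd a b c d h.1, polyF_shift_swap]; ring
  have s3 : ∑ q ∈ (quads p).filter (fun q => q.2.1 < q.2.2.1), F q
      = ∑ q ∈ (quads p).filter (fun q => q.2.2.2 < q.1), G q := by
    rw [sum_shift]
    refine Finset.sum_congr rfl ?_
    rintro ⟨a, b, c, d⟩ h
    rw [Finset.mem_filter] at h
    simp only [hF, hG]
    rw [Nat.cast_sub h.2.le, Nat.cast_add]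
  have s4 := sum_split p (fun q => q.2.1) (fun q => q.2.2.1) F
  have s5 := sum_split p (fun q => q.2.2.2) (fun q => q.1) G
  have s6 : ∑ q ∈ (quads p).filter (fun q => q.2.1 = q.2.2.1), F q
      = 6 * p * bernoulliChar p g 3 := by
    rw [sum_diag_bc p hp, ← bernoulliChar3 p hp.pos g hg0]
    refine Finset.sum_congr rfl fun d _ => ?_
    simp only [hF, hf1, Nat.cast_one, one_mul]
  have s7 : ∑ q ∈ (quads p).filter (fun q => q.2.2.2 = q.1), G q
      = 6 * p * bernoulliChar p f 5 := by
    rw [sum_diag_ad p hp, ← bernoulliChar5 p hp.pos f hf0]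
    refine Finset.sum_congr rfl fun d _ => ?_
    simp only [hG, hg1, Nat.cast_one, mul_one]
  have s8 : ∑ q ∈ quads p, F q - ∑ q ∈ quads p, G q = -12 * ∑ q ∈ quads p, H q := by
    have hs := sum_swap p (fun _ => True) (fun _ => True) (fun a b c d => Iff.rfl) H
    simp only [Finset.filter_true] at hs
    have e : -12 * ∑ q ∈ quads p, H q = -6 * ∑ q ∈ quads p, H q
        - 6 * ∑ q ∈ quads p, H (q.2.2.2, q.2.2.1, q.2.1, q.1) := by
      rw [← hs]; ring
    rw [e, ← Finset.sum_sub_distrib, Finset.mul_sum, Finset.mul_sum, ← Finset.sum_sub_distrib]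
    refine Finset.sum_congr rfl ?_
    rintro ⟨a, b, c, d⟩ h
    simp only [hF, hG, hH]
    rw [hodd a b c d h, ← mul_sub, polyF_sub]
    ring
  rw [s1, s6, s3] at s4
  rw [s2, s7] at s5
  rw [s4, s5] at s8
  linear_combination (1 / 12 : ℂ) * s8

end ConvTw

/-- For a prime `p > 2` and a primitive odd character `χ` mod `p`,
`∑_{n=1}^{p−1} σ_{2,𝟙,χ̄}(n) σ_{4,𝟙,χ}(p−n)(3p−8n) = (p/2)(B_{5,χ̄} − B_{3,χ})`. -/
theorem convolution_twisted_divisor_weight10 (p : ℕ) (hp : p.Prime) (hp2 : 2 < p)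
    (χ : DirichletCharacter ℂ p) (hprim : χ.IsPrimitive)
    (hoddχ : χ (-1) = -1) :
    ∑ n ∈ Finset.Ico 1 p,
        sigmaTw 2 (fun m => (starRingEnd ℂ) (χ ((m : ℕ) : ZMod p))) n
          * sigmaTw 4 (fun m => χ ((m : ℕ) : ZMod p)) (p - n)
          * (3 * (p : ℂ) - 8 * (n : ℂ))
      = (p : ℂ) / 2 *
          (bernoulliChar p (fun m => (starRingEnd ℂ) (χ ((m : ℕ) : ZMod p))) 5
            - bernoulliChar p (fun m => χ ((m : ℕ) : ZMod p)) 3) := by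
  have : Fact p.Prime := ⟨hp⟩
  have h0χ : χ 0 = 0 := χ.map_nonunit not_isUnit_zero
  refine (ConvTw.sum_quads_eq p (fun m => (starRingEnd ℂ) (χ ((m : ℕ) : ZMod p)))
    (fun m => χ ((m : ℕ) : ZMod p))).trans
    (ConvTw.main_identity p hp (fun m => (starRingEnd ℂ) (χ ((m : ℕ) : ZMod p)))
    (fun m => χ ((m : ℕ) : ZMod p)) ?_ ?_ ?_ ?_ ?_)
  · simp [h0χ]
  · simp [h0χ]
  · simp
  · simp
  · intro a b c d h
    have hmem := h
    simp only [ConvTw.quads, Finset.mem_filter, Finset.mem_product, Finset.mem_Ico] at hmem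
    obtain ⟨⟨-, ⟨hb1, hb2⟩, ⟨hc1, hc2⟩, -⟩, hpq⟩ := hmem
    have hz : (a : ZMod p) * b = (-1) * (c * d) := by
      have h0 : ((a * b + c * d : ℕ) : ZMod p) = 0 := by rw [hpq]; simp
      push_cast at h0
      linear_combination h0
    have hχ : χ (a : ZMod p) * χ (b : ZMod p) = - (χ (c : ZMod p) * χ (d : ZMod p)) := by
      rw [← map_mul, hz, map_mul, map_mul, hoddχ]; ring
    have hunit : ∀ m : ℕ, 1 ≤ m → m < p →
        (starRingEnd ℂ) (χ (m : ZMod p)) * χ (m : ZMod p) = 1 := by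
      intro m h1 h2
      have hu : IsUnit (m : ZMod p) := by
        rw [ZMod.isUnit_iff_coprime]
        exact (Nat.coprime_of_lt_prime (by omega) h2 hp).symm
      have hn : ‖χ (m : ZMod p)‖ = 1 := by
        obtain ⟨u, hu⟩ := hu
        rw [← hu]
        exact χ.unit_norm_eq_one u
      rw [mul_comm, Complex.mul_conj, Complex.normSq_eq_norm_sq, hn]
      norm_num
    have hb := hunit b hb1 hb2
    have hc := hunit c hc1 hc2
    linear_combination ((starRingEnd ℂ) (χ (c : ZMod p)) * (starRingEnd ℂ) (χ (b : ZMod p))) * hχ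
      - (starRingEnd ℂ) (χ (c : ZMod p)) * χ (a : ZMod p) * hb
      - (starRingEnd ℂ) (χ (b : ZMod p)) * χ (d : ZMod p) * hc
end

section
/- Let K ≥ 12 be even, D ≥ 1 odd square-free, χ a primitive quadratic character mod D with (−1)^{K/2}χ(−1) > 0, and k = K/2. Define ε_{K,D} as in the paper by a_{K,k,χ}(1) = 2σ_{k−1,χ}(0)(1 + ε_{K,D}). Then the explicit bound |ε_{K,D}| ≤ (ζ(k−1)²ζ(K−1)/(√e(2−ζ(k)))) (πeD/(K−2))^{(K−1)/2} + (eζ(k)/(2√(2π))) √(3/D) (πeD/(K−1))^k holds; in particular if K ≥ 10D + 2 then |ε_{K,D}| < 1 and hence a_{K,k,χ}(1) ≠ 0. -/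
open Real Complex

/-- `σ_{k−1,χ₁,χ₂}(n) = ∑_{d₁d₂=n} χ₁(d₁)χ₂(d₂)d₁^{k−1}` (zero at `n = 0`). -/
noncomputable def sigmaTwoChar (k : ℕ) (f₁ f₂ : ℕ → ℂ) (n : ℕ) : ℂ :=
  ∑ d ∈ n.divisors, f₁ d * f₂ (n / d) * (d : ℂ) ^ k

/-- Real zeta value `ζ(m) = ∑_{n≥1} n^{−m}`. -/
noncomputable def zetaReal (m : ℕ) : ℝ := ∑' n : ℕ+, (1 : ℝ) / (n : ℝ) ^ m

lemma zr_summ {m : ℕ} (hm : 2 ≤ m) : Summable (fun n : ℕ => (1 : ℝ) / (n : ℝ) ^ m) :=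
  Real.summable_one_div_nat_pow.mpr (by omega)

lemma zr_summ' {m : ℕ} (hm : 2 ≤ m) : Summable (fun n : ℕ+ => (1 : ℝ) / ((n : ℕ) : ℝ) ^ m) :=
  (zr_summ hm).comp_injective PNat.coe_injective

lemma zr_eq {m : ℕ} (hm : 2 ≤ m) : zetaReal m = ∑' n : ℕ, (1 : ℝ) / (n : ℝ) ^ m := by
  have h := tsum_zero_pnat_eq_tsum_nat (zr_summ hm)
  rw [← h]
  have : (m : ℕ) ≠ 0 := by omega
  simp [zetaReal, this]

lemma zr_one_le {m : ℕ} (hm : 2 ≤ m) : 1 ≤ zetaReal m := by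
  rw [zr_eq hm]
  have := (zr_summ hm).sum_le_tsum {1} (fun i _ => by positivity)
  simpa using this

lemma zr_le {m : ℕ} (hm : 4 ≤ m) : zetaReal m ≤ 1.0826 := by
  have h4 : zetaReal m ≤ π ^ 4 / 90 := by
    rw [zr_eq (by omega), ← hasSum_zeta_four.tsum_eq]
    refine (zr_summ (by omega)).tsum_le_tsum (fun n => ?_) hasSum_zeta_four.summable
    rcases Nat.eq_zero_or_pos n with rfl | hn
    · have : m ≠ 0 := by omega
      simp [this]
    · have : (1 : ℝ) ≤ n := by exact_mod_cast hn
      exact one_div_le_one_div_of_le (by positivity) (pow_le_pow_right₀ this hm)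
  have hp : π ^ 4 ≤ 3.1416 ^ 4 := pow_le_pow_left₀ pi_pos.le pi_lt_d4.le 4
  norm_num at hp ⊢
  linarith

lemma sum_inv_div (n m : ℕ) (hm : 2 ≤ m) :
    ∑ d ∈ n.divisors, (d : ℝ) ^ m ≤ (n : ℝ) ^ m * zetaReal m := by
  rw [← Nat.sum_div_divisors]
  calc ∑ d ∈ n.divisors, ((n / d : ℕ) : ℝ) ^ m
      = ∑ d ∈ n.divisors, (n : ℝ) ^ m * (1 / (d : ℝ) ^ m) := by
        refine Finset.sum_congr rfl fun d hd => ?_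
        have hdn := Nat.dvd_of_mem_divisors hd
        have hd0 : (d : ℝ) ≠ 0 := by
          exact_mod_cast (Nat.pos_of_mem_divisors hd).ne'
        rw [Nat.cast_div hdn hd0, div_pow]
        ring
    _ = (n : ℝ) ^ m * ∑ d ∈ n.divisors, (1 / (d : ℝ) ^ m) := by rw [Finset.mul_sum]
    _ ≤ _ := by
        rw [zr_eq hm]
        gcongr
        exact (zr_summ hm).sum_le_tsum _ (fun i _ => by positivity)

lemma sigma_bd (m n : ℕ) (hm : 2 ≤ m) (f₁ f₂ : ℕ → ℂ) (h₁ : ∀ n, ‖f₁ n‖ ≤ 1)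
    (h₂ : ∀ n, ‖f₂ n‖ ≤ 1) : ‖sigmaTwoChar m f₁ f₂ n‖ ≤ (n : ℝ) ^ m * zetaReal m := by
  refine le_trans ?_ (sum_inv_div n m hm)
  refine norm_sum_le_of_le _ fun d _ => ?_
  rw [norm_mul, norm_mul, norm_pow, Complex.norm_natCast]
  have : ‖f₁ d‖ * ‖f₂ (n / d)‖ ≤ 1 := mul_le_one₀ (h₁ _) (norm_nonneg _) (h₂ _)
  have h3 : (0 : ℝ) ≤ (d : ℝ) ^ m := by positivity
  nlinarith

lemma conv_bd (m d : ℕ) (hm : 2 ≤ m) (f₁ f₂ : ℕ → ℂ) (h₁ : ∀ n, ‖f₁ n‖ ≤ 1)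
    (h₂ : ∀ n, ‖f₂ n‖ ≤ 1) :
    ‖∑ j ∈ Finset.range (d + 1), sigmaTwoChar m f₁ f₂ j * sigmaTwoChar m f₁ f₂ (d - j)‖
      ≤ zetaReal m ^ 2 * ((d : ℝ) ^ (2 * m + 1) / 4 ^ m) := by
  have hz := zr_one_le hm
  rw [Finset.sum_range_succ']
  have h0 : sigmaTwoChar m f₁ f₂ 0 = 0 := by simp [sigmaTwoChar]
  rw [h0, zero_mul, add_zero]
  have : ∀ j ∈ Finset.range d,
      ‖sigmaTwoChar m f₁ f₂ (j + 1) * sigmaTwoChar m f₁ f₂ (d - (j + 1))‖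
        ≤ zetaReal m ^ 2 * (((d : ℝ) ^ 2 / 4) ^ m) := by
    intro j hj
    have hj' : j + 1 ≤ d := Finset.mem_range.mp hj
    rw [norm_mul]
    have a := sigma_bd m (j + 1) hm f₁ f₂ h₁ h₂
    have b := sigma_bd m (d - (j + 1)) hm f₁ f₂ h₁ h₂
    calc _ ≤ (((j + 1 : ℕ) : ℝ) ^ m * zetaReal m) * (((d - (j + 1) : ℕ) : ℝ) ^ m * zetaReal m) :=
          mul_le_mul a b (norm_nonneg _) (by positivity)
      _ = zetaReal m ^ 2 * ((((j + 1 : ℕ) : ℝ) * ((d - (j + 1) : ℕ) : ℝ)) ^ m) := by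
          rw [mul_pow]; ring
      _ ≤ _ := by
          gcongr
          rw [Nat.cast_sub hj']
          nlinarith [sq_nonneg ((d : ℝ) - 2 * ((j + 1 : ℕ) : ℝ))]
  refine (norm_sum_le_of_le _ this).trans (le_of_eq ?_)
  rw [Finset.sum_const, Finset.card_range, nsmul_eq_mul, div_pow, ← pow_mul]
  ring

lemma gauss_norm_s19 (D : ℕ) (hD : 1 ≤ D) (χ : DirichletCharacter ℂ D) (hprim : χ.IsPrimitive)
    (hquad : χ * χ = 1) :
    ‖gaussSumOf D (fun m => χ ((m : ℕ) : ZMod D))‖ = √D := by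
  have : NeZero D := ⟨by omega⟩
  have hinv : χ⁻¹ = χ := inv_eq_of_mul_eq_one_right hquad
  have hG : gaussSumOf D (fun m => χ ((m : ℕ) : ZMod D)) = gaussSum χ ZMod.stdAddChar := by
    unfold gaussSumOf gaussSum
    symm
    refine Finset.sum_bij (fun a _ => ZMod.val a) (fun a _ => by simpa using ZMod.val_lt a)
      (fun a _ b _ h => ZMod.val_injective D h) (fun b hb => ?_) (fun a _ => ?_)
    · exact ⟨(b : ZMod D), Finset.mem_univ _, ZMod.val_cast_of_lt (Finset.mem_range.mp hb)⟩
    · have := ZMod.stdAddChar_coe (N := D) (a.val : ℤ)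
      push_cast at this
      rw [ZMod.natCast_zmod_val] at this
      simp [this]
  rw [hG]
  set G := gaussSum χ ZMod.stdAddChar
  have h1 : ZMod.dft (χ : ZMod D → ℂ) = fun k => χ (-k) * G := by
    funext k
    rw [hprim.fourierTransform_eq_inv_mul_gaussSum, hinv]
  have h2 := congrFun (ZMod.dft_dft (χ : ZMod D → ℂ)) 1
  rw [h1, ZMod.dft_mul_const (fun k => χ (-k)) G, ZMod.dft_comp_neg] at h2
  simp only [h1] at h2
  simp only [neg_neg, map_one, one_mul, smul_eq_mul] at h2
  have h3 : ‖G‖ * ‖G‖ = D := by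
    rw [← norm_mul, h2, norm_mul, Complex.norm_natCast]
    have := χ.unit_norm_eq_one (-1)
    push_cast at this
    rw [this, mul_one]
  rw [← h3, Real.sqrt_mul_self (norm_nonneg _)]

lemma L_bd (k D : ℕ) (hk : 2 ≤ k) (χ : DirichletCharacter ℂ D) :
    ‖∑' n : ℕ+, χ (((n : ℕ) : ℕ) : ZMod D) / ((n : ℕ) : ℂ) ^ k‖ ≤ zetaReal k ∧
    2 - zetaReal k ≤ ‖∑' n : ℕ+, χ (((n : ℕ) : ℕ) : ZMod D) / ((n : ℕ) : ℂ) ^ k‖ := by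
  have hb : ∀ n : ℕ+, ‖χ (((n : ℕ) : ℕ) : ZMod D) / ((n : ℕ) : ℂ) ^ k‖
      ≤ 1 / ((n : ℕ) : ℝ) ^ k := by
    intro n
    rw [norm_div, norm_pow, Complex.norm_natCast]
    gcongr
    exact χ.norm_le_one _
  have hs : Summable fun n : ℕ+ => χ (((n : ℕ) : ℕ) : ZMod D) / ((n : ℕ) : ℂ) ^ k :=
    Summable.of_norm_bounded (zr_summ' hk) hb
  refine ⟨tsum_of_norm_bounded (zr_summ' hk).hasSum hb, ?_⟩
  have hz : zetaReal k = 1 + ∑' n : ℕ+, if n = 1 then 0 else 1 / ((n : ℕ) : ℝ) ^ k := by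
    unfold zetaReal
    rw [(zr_summ' hk).tsum_eq_add_tsum_ite 1]
    simp
  rw [hs.tsum_eq_add_tsum_ite 1, hz]
  have hs2 : Summable fun n : ℕ+ => if n = 1 then 0 else 1 / ((n : ℕ) : ℝ) ^ k := by
    refine (zr_summ' hk).of_nonneg_of_le (fun n => ?_) (fun n => ?_) <;> split_ifs <;>
      first | positivity | simp
  have h3 : ‖∑' n : ℕ+, if n = 1 then 0 else χ (((n : ℕ) : ℕ) : ZMod D) / ((n : ℕ) : ℂ) ^ k‖
      ≤ ∑' n : ℕ+, if n = 1 then 0 else 1 / ((n : ℕ) : ℝ) ^ k := by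
    refine tsum_of_norm_bounded hs2.hasSum fun n => ?_
    split_ifs
    · simp
    · exact hb n
  have h4 : χ ((((1 : ℕ+) : ℕ) : ℕ) : ZMod D) / (((1 : ℕ+) : ℕ) : ℂ) ^ k = 1 := by simp
  rw [h4]
  have h5 := norm_sub_le_norm_add (1 : ℂ)
    (∑' n : ℕ+, if n = 1 then 0 else χ (((n : ℕ) : ℕ) : ZMod D) / ((n : ℕ) : ℂ) ^ k)
  rw [norm_one] at h5
  linarith

lemma zeta_bd (K : ℕ) (hKeven : Even K) (hK : 12 ≤ K) :
    2 * ((K - 1).factorial : ℝ) / (2 * π) ^ K ≤ ‖riemannZeta (1 - (K : ℂ))‖ := by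
  rw [riemannZeta_one_sub (s := (K : ℂ))
    (fun n h => by
      have : (K : ℂ) + n = 0 := by rw [h]; ring
      have h2 : K + n = 0 := by exact_mod_cast this
      omega)
    (by
      intro h
      have h2 : K = 1 := by exact_mod_cast h
      omega)]
  obtain ⟨k, rfl⟩ := hKeven
  have hc : ‖Complex.cos (π * ((k + k : ℕ) : ℂ) / 2)‖ = 1 := by
    have : (π * ((k + k : ℕ) : ℂ) / 2) = ((k * π : ℝ) : ℂ) := by push_cast; ring
    rw [this, ← Complex.ofReal_cos, Complex.norm_real, Real.cos_nat_mul_pi]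
    simp
  have hz : 1 ≤ ‖riemannZeta ((k + k : ℕ) : ℂ)‖ := by
    rw [zeta_nat_eq_tsum_of_gt_one (by omega)]
    have : ∑' n : ℕ, 1 / (n : ℂ) ^ (k + k) = ((zetaReal (k + k) : ℝ) : ℂ) := by
      rw [zr_eq (by omega)]
      push_cast
      rfl
    rw [this, Complex.norm_real]
    exact (zr_one_le (by omega)).trans (le_abs_self _)
  have hg : ‖Complex.Gamma ((k + k : ℕ) : ℂ)‖ = ((k + k - 1).factorial : ℝ) := by
    have h := Complex.Gamma_nat_eq_factorial (k + k - 1)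
    have h2 : ((k + k - 1 : ℕ) : ℂ) + 1 = ((k + k : ℕ) : ℂ) := by
      rw [← Nat.cast_succ]; congr 1; omega
    rw [h2] at h
    rw [h, Complex.norm_natCast]
  have hp : ‖(2 * (π : ℂ)) ^ (-((k + k : ℕ) : ℂ))‖ = 1 / (2 * π) ^ (k + k) := by
    rw [Complex.cpow_neg, Complex.cpow_natCast, norm_inv, norm_pow, norm_mul, Complex.norm_real,
      Real.norm_of_nonneg pi_pos.le]
    simp
  rw [norm_mul, norm_mul, norm_mul, norm_mul, hc, hg, hp]
  have : 0 ≤ ‖(2 : ℂ)‖ * (1 / (2 * π) ^ (k + k)) * ((k + k - 1).factorial : ℝ) * 1 := by positivity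
  refine le_trans (le_of_eq ?_) (le_mul_of_one_le_right this hz)
  simp
  ring

lemma fact_upper (m : ℕ) (hm : 1 ≤ m) :
    (m.factorial : ℝ) ≤ Real.exp 1 * √m * (m / Real.exp 1) ^ m := by
  obtain ⟨n, rfl⟩ : ∃ n, m = n + 1 := ⟨m - 1, by omega⟩
  have h := Stirling.stirlingSeq'_antitone (Nat.zero_le n)
  simp only [Function.comp, Nat.succ_eq_add_one, zero_add, Stirling.stirlingSeq_one] at h
  rw [Stirling.stirlingSeq, div_le_iff₀ (by positivity)] at h
  refine h.trans (le_of_eq ?_)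
  rw [Real.sqrt_mul (by norm_num)]
  have : √(2 : ℝ) ≠ 0 := by positivity
  field_simp

lemma E1 (m D : ℕ) (hm : 1 ≤ m) :
    (2 * π) ^ (m + 1) / (2 * (m.factorial : ℝ) * 4 ^ m) * ((D : ℝ) ^ m * √D)
      ≤ 1 / √(Real.exp 1) * ((π * Real.exp 1 * D / (2 * m)) ^ m *
        √(π * Real.exp 1 * D / (2 * m))) := by
  have hm0 : (0 : ℝ) < m := by exact_mod_cast hm
  have he := Real.exp_pos 1
  have hs := Stirling.le_factorial_stirling m
  have hf : (0 : ℝ) < m.factorial := by exact_mod_cast m.factorial_pos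
  have hsq : √(π * Real.exp 1 * D / (2 * m)) = √π * √(Real.exp 1) * √D / √(2 * m) := by
    rw [Real.sqrt_div (by positivity), Real.sqrt_mul (by positivity), Real.sqrt_mul (by positivity)]
  have hs2 : √(2 * π * m) = √π * √(2 * m) := by
    rw [← Real.sqrt_mul pi_pos.le]; congr 1; ring
  rw [hs2] at hs
  set E := Real.exp 1
  have hpi : √π * √π = π := Real.mul_self_sqrt pi_pos.le
  have hp : 0 < √π := Real.sqrt_pos.mpr pi_pos
  have h2m : 0 < √(2 * (m : ℝ)) := by positivity
  have hE : 0 < √E := by positivity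
  have l1 : (2 * π) ^ (m + 1) / (2 * (m.factorial : ℝ) * 4 ^ m) * ((D : ℝ) ^ m * √D)
      = (π ^ m * (D : ℝ) ^ m * √D / 2 ^ m) * (π / m.factorial) := by
    have : (4 : ℝ) ^ m = 2 ^ m * 2 ^ m := by rw [← mul_pow]; norm_num
    rw [this, mul_pow]
    field_simp
    ring
  have l2 : 1 / √E * ((π * E * D / (2 * m)) ^ m * √(π * E * D / (2 * m)))
      = (π ^ m * (D : ℝ) ^ m * √D / 2 ^ m) * (√π / (√(2 * m) * (m / E) ^ m)) := by
    rw [hsq, div_pow, div_pow, mul_pow, mul_pow, mul_pow]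
    field_simp
  rw [l1, l2]
  refine mul_le_mul_of_nonneg_left ?_ (by positivity)
  rw [div_le_div_iff₀ hf (by positivity)]
  calc π * (√(2 * m) * (m / E) ^ m) = √π * (√π * √(2 * m) * (m / E) ^ m) := by
        nth_rw 1 [← hpi]; ring
    _ ≤ _ := by gcongr

lemma E2 (m : ℕ) (hm : 1 ≤ m) :
    (m.factorial : ℝ) * (2 * π) ^ (m + 1) / ((2 * m + 1).factorial : ℝ)
      ≤ Real.exp 1 * √3 / √(2 * π) * (π * Real.exp 1 / (2 * m + 1)) ^ (m + 1) := by
  have hm0 : (0 : ℝ) < m := by exact_mod_cast hm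
  have he := Real.exp_pos 1
  have hs := Stirling.le_factorial_stirling (2 * m + 1)
  have hu := fact_upper m hm
  push_cast at hs
  rw [Real.sqrt_mul (by positivity)] at hs
  set E := Real.exp 1
  set N : ℝ := 2 * m + 1 with hN
  have hN0 : 0 < N := by positivity
  have hf : (0 : ℝ) < (2 * m + 1).factorial := by exact_mod_cast Nat.factorial_pos _
  have hq : 0 < √(2 * π) := by positivity
  have h1 : 2 * √(m : ℝ) ≤ √3 * √N := by
    rw [← Real.sqrt_mul (by norm_num)]
    apply Real.le_sqrt_of_sq_le
    rw [mul_pow, Real.sq_sqrt hm0.le]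
    rw [hN]; linarith
  have h2 : (2 * (m : ℝ)) ^ m ≤ N ^ m := by
    gcongr; rw [hN]; linarith
  rw [div_le_iff₀ hf]
  calc (m.factorial : ℝ) * (2 * π) ^ (m + 1)
      ≤ (E * √m * (m / E) ^ m) * (2 * π) ^ (m + 1) := by gcongr
    _ = E * π ^ (m + 1) / E ^ m * ((2 * √m) * (2 * (m : ℝ)) ^ m) := by
        rw [div_pow, mul_pow, mul_pow]; field_simp; ring
    _ ≤ E * π ^ (m + 1) / E ^ m * ((√3 * √N) * N ^ m) := by gcongr
    _ = E * √3 / √(2 * π) * (π * E / N) ^ (m + 1) * (√(2 * π) * √N * (N / E) ^ (2 * m + 1)) := by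
        rw [div_pow, div_pow, mul_pow]
        have a : N ^ (2 * m + 1) = N ^ (m + 1) * N ^ m := by rw [← pow_add]; congr 1; ring
        have b : E ^ (2 * m + 1) = E ^ (m + 1) * E ^ m := by rw [← pow_add]; congr 1; ring
        rw [a, b]
        field_simp
    _ ≤ _ := by gcongr

lemma numer (z1 z2 z3 x y s3 : ℝ) (m : ℕ) (hm : 5 ≤ m)
    (a1 : 1 ≤ z1) (b1 : z1 ≤ 1.0826) (a2 : 1 ≤ z2) (b2 : z2 ≤ 1.0826)
    (a3 : 1 ≤ z3) (b3 : z3 ≤ 1.0826)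
    (hx : 0 ≤ x) (hx' : x ≤ 0.8545) (hy : 0 ≤ y) (hy' : y ≤ 0.8545) (hs : 0 ≤ s3)
    (hs' : s3 ≤ 1.7321) :
    z1 ^ 2 * z2 / (√(Real.exp 1) * (2 - z3)) * (x ^ m * √x)
      + Real.exp 1 * z3 / (2 * √(2 * π)) * s3 * y ^ (m + 1) < 1 := by
  have he1 := Real.exp_one_gt_d9
  have he2 := Real.exp_one_lt_d9
  have hp := pi_gt_d4
  have hse : 1.6 ≤ √(Real.exp 1) := Real.le_sqrt_of_sq_le (by norm_num at *; linarith)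
  have hsp : 2.5 ≤ √(2 * π) := Real.le_sqrt_of_sq_le (by norm_num at *; linarith)
  have hsx : √x ≤ 0.93 := Real.sqrt_le_iff.mpr ⟨by norm_num, by norm_num at *; linarith⟩
  have hxm : x ^ m ≤ 0.8545 ^ 5 :=
    (pow_le_pow_left₀ hx hx' m).trans (pow_le_pow_of_le_one (by norm_num) (by norm_num) hm)
  have hym : y ^ (m + 1) ≤ 0.8545 ^ 6 :=
    (pow_le_pow_left₀ hy hy' _).trans (pow_le_pow_of_le_one (by norm_num) (by norm_num) (by omega))
  have t1 : z1 ^ 2 * z2 / (√(Real.exp 1) * (2 - z3)) * (x ^ m * √x)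
      ≤ 1.0826 ^ 2 * 1.0826 / (1.6 * (2 - 1.0826)) * (0.8545 ^ 5 * 0.93) := by
    gcongr
  have t2 : Real.exp 1 * z3 / (2 * √(2 * π)) * s3 * y ^ (m + 1)
      ≤ 2.7182818286 * 1.0826 / (2 * 2.5) * 1.7321 * 0.8545 ^ 6 := by
    gcongr
  refine (add_le_add t1 t2).trans_lt (by norm_num)

/-- For even `K ≥ 12`, `D ≥ 1` odd square-free, `χ` a primitive quadratic character mod `D`
with `(−1)^{K/2}χ(−1) = 1` and `k = K/2`: writing the first Fourier coefficient of the
cuspidal projection as `a_{K,k,χ}(1) = 2σ_{k−1,χ}(0)(1+ε)`, one has the explicit bound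
`|ε| ≤ ζ(k−1)²ζ(K−1)/(√e(2−ζ(k))) (πeD/(K−2))^{(K−1)/2}
      + (eζ(k)/(2√(2π))) √(3/D) (πeD/(K−1))^k`,
and if `K ≥ 10D+2` then `|ε| < 1` and `a_{K,k,χ}(1) ≠ 0`.  The coefficient `a_{K,k,χ}(1)`
is given explicitly in terms of the (unique) factorizations `χ = χ₁χ₂` into primitive
characters modulo complementary divisors `D₁D₂ = D`. -/
theorem epsilon_bound_and_nonvanishing (K D : ℕ) (hKeven : Even K) (hK : 12 ≤ K)
    (hD : 1 ≤ D) (hodd : Odd D) (hsf : Squarefree D)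
    (χ : DirichletCharacter ℂ D) (hprim : χ.IsPrimitive) (hquad : χ * χ = 1)
    (hsign : (-1 : ℂ) ^ (K / 2) * χ (-1) = 1)
    (k : ℕ) (hk : k = K / 2)
    (χ₁ : ∀ d : ℕ, DirichletCharacter ℂ (D / d))
    (χ₂ : ∀ d : ℕ, DirichletCharacter ℂ d)
    (hfact : ∀ d ∈ D.divisors, (χ₁ d).IsPrimitive ∧ (χ₂ d).IsPrimitive ∧
      ∀ m : ℕ, Nat.Coprime m D →
        χ ((m : ℕ) : ZMod D) = χ₁ d ((m : ℕ) : ZMod (D / d)) * χ₂ d ((m : ℕ) : ZMod d))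
    (σ0 : ℂ) (hσ0 : σ0 = sigmaZero D k (fun m => χ ((m : ℕ) : ZMod D)))
    (a1 : ℂ)
    (ha1 : a1 = 2 * σ0
      + (∑ d ∈ D.divisors.erase 1, (χ₂ d (-1))⁻¹ *
          ∑ j ∈ Finset.range (d + 1),
            sigmaTwoChar (k - 1) (fun m => χ₁ d ((m : ℕ) : ZMod (D / d)))
                (fun m => χ₂ d ((m : ℕ) : ZMod d)) j *
              sigmaTwoChar (k - 1) (fun m => χ₁ d ((m : ℕ) : ZMod (D / d)))
                (fun m => χ₂ d ((m : ℕ) : ZMod d)) (d - j))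
      - 2 * σ0 ^ 2 / riemannZeta (1 - (K : ℂ)))
    (ε : ℂ) (hε : a1 = 2 * σ0 * (1 + ε)) :
    ‖ε‖ ≤ zetaReal (k - 1) ^ 2 * zetaReal (K - 1)
            / (Real.sqrt (Real.exp 1) * (2 - zetaReal k))
            * (π * Real.exp 1 * D / ((K : ℝ) - 2)) ^ (((K : ℝ) - 1) / 2)
          + Real.exp 1 * zetaReal k / (2 * Real.sqrt (2 * π)) * Real.sqrt (3 / D)
            * (π * Real.exp 1 * D / ((K : ℝ) - 1)) ^ k
      ∧ (10 * D + 2 ≤ K → ‖ε‖ < 1 ∧ a1 ≠ 0) := by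
  have hk2 : K = 2 * k := by
    obtain ⟨r, hr⟩ := hKeven
    omega
  obtain ⟨m, rfl⟩ : ∃ m, k = m + 1 := ⟨k - 1, by omega⟩
  have hm : 5 ≤ m := by omega
  have hz1 := zr_one_le (m := m) (by omega)
  have hz1' := zr_le (m := m) (by omega)
  have hz2 := zr_one_le (m := K - 1) (by omega)
  have hz2' := zr_le (m := K - 1) (by omega)
  have hz3 := zr_one_le (m := m + 1) (by omega)
  have hz3' := zr_le (m := m + 1) (by omega)
  have hL := L_bd (m + 1) D (by omega) χ
  have hG := gauss_norm_s19 D hD χ hprim hquad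
  have hζ := zeta_bd K hKeven hK
  have hD0 : (0 : ℝ) < D := by exact_mod_cast hD
  have hm0 : (0 : ℝ) < m := by exact_mod_cast (by omega : 0 < m)
  have hsD : 0 < √(D : ℝ) := by positivity
  have hpi := pi_pos
  have hf : (0 : ℝ) < m.factorial := by exact_mod_cast m.factorial_pos
  have hf2 : (0 : ℝ) < (2 * m + 1).factorial := by exact_mod_cast Nat.factorial_pos _
  have h2z : 0 < 2 - zetaReal (m + 1) := by norm_num at hz3' ⊢; linarith
  have hK1 : K - 1 = 2 * m + 1 := by omega
  have hKr : (K : ℝ) = 2 * m + 2 := by rw [hk2]; push_cast; ring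
  have hσn : ‖σ0‖ = (m.factorial : ℝ) * (D : ℝ) ^ (m + 1) *
      ‖∑' n : ℕ+, χ (((n : ℕ) : ℕ) : ZMod D) / ((n : ℕ) : ℂ) ^ (m + 1)‖
        / ((2 * π) ^ (m + 1) * √D) := by
    rw [hσ0, sigmaZero, norm_div, norm_mul, norm_mul, norm_mul, hG, norm_pow, norm_pow, norm_neg,
      norm_mul, norm_mul, Complex.norm_real, Complex.norm_I, Real.norm_of_nonneg hpi.le]
    simp
  have hσl : (m.factorial : ℝ) * (D : ℝ) ^ (m + 1) * (2 - zetaReal (m + 1))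
        / ((2 * π) ^ (m + 1) * √D) ≤ ‖σ0‖ := by
    rw [hσn]; gcongr; exact hL.2
  have hσu : ‖σ0‖ ≤ (m.factorial : ℝ) * (D : ℝ) ^ (m + 1) * zetaReal (m + 1)
        / ((2 * π) ^ (m + 1) * √D) := by
    rw [hσn]; gcongr; exact hL.1
  have hσpos : 0 < ‖σ0‖ := lt_of_lt_of_le (by positivity) hσl
  have hσne : σ0 ≠ 0 := norm_pos_iff.mp hσpos
  have hζpos : 0 < ‖riemannZeta (1 - (K : ℂ))‖ := lt_of_lt_of_le (by positivity) hζ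
  have hζne := norm_pos_iff.mp hζpos
  rw [Nat.add_sub_cancel] at ha1 ⊢
  obtain ⟨A, hA⟩ : ∃ A : ℂ, A = (∑ d ∈ D.divisors.erase 1, (χ₂ d (-1))⁻¹ *
          ∑ j ∈ Finset.range (d + 1),
            sigmaTwoChar m (fun m => χ₁ d ((m : ℕ) : ZMod (D / d)))
                (fun m => χ₂ d ((m : ℕ) : ZMod d)) j *
              sigmaTwoChar m (fun m => χ₁ d ((m : ℕ) : ZMod (D / d)))
                (fun m => χ₂ d ((m : ℕ) : ZMod d)) (d - j)) := ⟨_, rfl⟩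
  rw [← hA] at ha1
  have hεeq : ε = A / (2 * σ0) - σ0 / riemannZeta (1 - (K : ℂ)) := by
    rw [ha1] at hε
    field_simp
    field_simp at hε
    linear_combination (-1 : ℂ) * hε
  have hAn : ‖A‖ ≤ zetaReal m ^ 2 / 4 ^ m * ((D : ℝ) ^ (2 * m + 1) * zetaReal (K - 1)) := by
    rw [hK1]
    calc ‖A‖ ≤ ∑ d ∈ D.divisors.erase 1, zetaReal m ^ 2 * ((d : ℝ) ^ (2 * m + 1) / 4 ^ m) := by
          rw [hA]
          refine norm_sum_le_of_le _ fun d _ => ?_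
          have hu : ‖χ₂ d (-1)‖ = 1 := by
            have := (χ₂ d).unit_norm_eq_one (-1)
            push_cast at this
            exact this
          rw [norm_mul, norm_inv, hu, inv_one, one_mul]
          exact conv_bd m d (by omega) _ _ (fun n => (χ₁ d).norm_le_one _)
            (fun n => (χ₂ d).norm_le_one _)
      _ ≤ ∑ d ∈ D.divisors, zetaReal m ^ 2 * ((d : ℝ) ^ (2 * m + 1) / 4 ^ m) :=
          Finset.sum_le_sum_of_subset_of_nonneg (Finset.erase_subset _ _)
            (fun i _ _ => by positivity)
      _ = zetaReal m ^ 2 / 4 ^ m * ∑ d ∈ D.divisors, (d : ℝ) ^ (2 * m + 1) := by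
          rw [Finset.mul_sum]
          exact Finset.sum_congr rfl fun d _ => by ring
      _ ≤ _ := by
          gcongr
          exact sum_inv_div D (2 * m + 1) (by omega)
  have hpow : (π * Real.exp 1 * D / ((K : ℝ) - 2)) ^ (((K : ℝ) - 1) / 2)
      = (π * Real.exp 1 * D / (2 * m)) ^ m * √(π * Real.exp 1 * D / (2 * m)) := by
    have e1 : (K : ℝ) - 2 = 2 * m := by rw [hKr]; ring
    have e2 : ((K : ℝ) - 1) / 2 = (m : ℝ) + 1 / 2 := by rw [hKr]; ring
    rw [e1, e2, Real.rpow_add (by positivity), Real.rpow_natCast, Real.sqrt_eq_rpow]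
  have hK1r : (K : ℝ) - 1 = 2 * m + 1 := by rw [hKr]; ring
  have hT1 : ‖A / (2 * σ0)‖ ≤ zetaReal m ^ 2 * zetaReal (K - 1)
            / (Real.sqrt (Real.exp 1) * (2 - zetaReal (m + 1)))
            * ((π * Real.exp 1 * D / (2 * m)) ^ m * √(π * Real.exp 1 * D / (2 * m))) := by
    have h := E1 m D (by omega)
    rw [norm_div, norm_mul, Complex.norm_ofNat]
    calc ‖A‖ / (2 * ‖σ0‖) ≤ (zetaReal m ^ 2 / 4 ^ m * ((D : ℝ) ^ (2 * m + 1) * zetaReal (K - 1))) /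
          (2 * ((m.factorial : ℝ) * (D : ℝ) ^ (m + 1) * (2 - zetaReal (m + 1))
            / ((2 * π) ^ (m + 1) * √D))) := by gcongr
      _ = zetaReal m ^ 2 * zetaReal (K - 1) / (2 - zetaReal (m + 1)) *
          ((2 * π) ^ (m + 1) / (2 * (m.factorial : ℝ) * 4 ^ m) * ((D : ℝ) ^ m * √D)) := by
          have e : (D : ℝ) ^ (2 * m + 1) = (D : ℝ) ^ (m + 1) * (D : ℝ) ^ m := by
            rw [← pow_add]; congr 1; ring
          rw [e]
          field_simp
      _ ≤ zetaReal m ^ 2 * zetaReal (K - 1) / (2 - zetaReal (m + 1)) *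
          (1 / √(Real.exp 1) * ((π * Real.exp 1 * D / (2 * m)) ^ m *
            √(π * Real.exp 1 * D / (2 * m)))) := mul_le_mul_of_nonneg_left h (by positivity)
      _ = _ := by
          have : 0 < √(Real.exp 1) := by positivity
          field_simp
  have hT2 : ‖σ0 / riemannZeta (1 - (K : ℂ))‖ ≤
      Real.exp 1 * zetaReal (m + 1) / (2 * Real.sqrt (2 * π)) * Real.sqrt (3 / D)
            * (π * Real.exp 1 * D / (2 * m + 1)) ^ (m + 1) := by
    have h := E2 m (by omega)
    rw [norm_div]
    rw [hK1] at hζ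
    have hKm : K = (m + 1) + (m + 1) := by omega
    calc ‖σ0‖ / ‖riemannZeta (1 - (K : ℂ))‖ ≤
          ((m.factorial : ℝ) * (D : ℝ) ^ (m + 1) * zetaReal (m + 1)
            / ((2 * π) ^ (m + 1) * √D)) / (2 * ((2 * m + 1).factorial : ℝ) / (2 * π) ^ K) := by
          gcongr
      _ = zetaReal (m + 1) * (D : ℝ) ^ (m + 1) / (2 * √D) *
          ((m.factorial : ℝ) * (2 * π) ^ (m + 1) / ((2 * m + 1).factorial : ℝ)) := by
          have e : (2 * π) ^ K = (2 * π) ^ (m + 1) * (2 * π) ^ (m + 1) := by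
            rw [← pow_add]; congr 1
          rw [e]
          field_simp
      _ ≤ zetaReal (m + 1) * (D : ℝ) ^ (m + 1) / (2 * √D) *
          (Real.exp 1 * √3 / √(2 * π) * (π * Real.exp 1 / (2 * m + 1)) ^ (m + 1)) :=
          mul_le_mul_of_nonneg_left h (by positivity)
      _ = _ := by
          rw [Real.sqrt_div (by norm_num), div_pow, div_pow, mul_pow _ (D : ℝ)]
          have : 0 < √(2 * π) := by positivity
          field_simp
  have hmain := (norm_sub_le _ _).trans (add_le_add hT1 hT2)
  rw [← hεeq] at hmain
  rw [hpow, hK1r]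
  refine ⟨hmain, fun hKD => ?_⟩
  have hlt : ‖ε‖ < 1 := by
    refine hmain.trans_lt ?_
    have hDm : 10 * (D : ℝ) ≤ 2 * m := by
      have : 10 * D ≤ 2 * m := by omega
      exact_mod_cast this
    have hpe : π * Real.exp 1 ≤ 8.545 := by
      have h1 := Real.exp_one_lt_d9
      have h2 := pi_lt_d4
      calc π * Real.exp 1 ≤ 3.1416 * 2.7182818286 := by gcongr
        _ ≤ _ := by norm_num
    have hx : π * Real.exp 1 * D / (2 * m) ≤ 0.8545 := by
      rw [div_le_iff₀ (by positivity)]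
      norm_num at hpe ⊢
      nlinarith
    have hy : π * Real.exp 1 * D / (2 * m + 1) ≤ 0.8545 := by
      refine le_trans ?_ hx
      gcongr
      linarith
    have hs : √(3 / (D : ℝ)) ≤ 1.7321 := by
      refine Real.sqrt_le_iff.mpr ⟨by norm_num, ?_⟩
      rw [div_le_iff₀ hD0]
      have : (1 : ℝ) ≤ D := by exact_mod_cast hD
      norm_num
      linarith
    exact numer _ _ _ _ _ _ m hm hz1 hz1' hz2 hz2' hz3 hz3' (by positivity) hx (by positivity) hy
      (Real.sqrt_nonneg _) hs
  refine ⟨hlt, ?_⟩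
  rw [hε]
  refine mul_ne_zero (mul_ne_zero two_ne_zero hσne) fun h => ?_
  have : ε = -1 := by linear_combination h
  rw [this] at hlt
  simp at hlt
end
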